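/- arXiv:2005.11745 — 2 statements merged into one kernel-verified Lean document; each statement's English description precedes it below -/
import Mathlib

section
/- Let ρ > 1/2, ϵ > 0, and let δ₁, δ₂ be real numbers with π/(2ρ) < δ₁ ≤ min(π, π/ρ) and π/(2ρ) < δ₂ ≤ min(π, π/ρ). Let μ ∈ ℂ and let z = R·exp(iθ) with R > 0 and π/(2ρ) − δ₂ + π < θ < −π/(2ρ) + δ₁ + π. Then the Mittag-Leffler function admits the representation E_{ρ,μ}(z) = −∫_{1+ϵ}^{∞} φ_{ρ,μ}(r, −δ₁−π, z)·e^{i(−δ₁−π)}/(r·e^{i(−δ₁−π)} − 1) dr + i·∫_{−δ₁−π}^{δ₂−π} φ_{ρ,μ}(1+ϵ, φ, z)·(1+ϵ)·e^{iφ}/((1+ϵ)·e^{iφ} − 1) dφ + ∫_{1+ϵ}^{∞} φ_{ρ,μ}(r, δ₂−π, z)·e^{i(δ₂−π)}/(r·e^{i(δ₂−π)} − 1) dr. -/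
open scoped Real
open MeasureTheory intervalIntegral

/-- The two-parameter Mittag-Leffler function
`E_{ρ,μ}(z) = ∑_{k=0}^∞ z^k / Γ(μ + k/ρ)`. -/
noncomputable def ML (ρ : ℝ) (μ z : ℂ) : ℂ :=
  ∑' k : ℕ, z ^ k * (Complex.Gamma (μ + (k : ℂ) / (ρ : ℂ)))⁻¹

/-- `φ_{ρ,μ}(ζ,z) = (ρ/(2πi)) exp((ζz)^ρ) (ζz)^{ρ(1-μ)}` at `ζ = r e^{iφ}`,
on the branch fixed by `arg z = θ`, `z = R e^{iθ}`. -/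
noncomputable def phiFun (ρ : ℝ) (μ : ℂ) (R θ r φ : ℝ) : ℂ :=
  ((ρ : ℂ) / (2 * (π : ℂ) * Complex.I)) *
    Complex.exp (Complex.exp ((ρ : ℂ) * ((Real.log (R * r) : ℂ) + Complex.I * ((θ + φ : ℝ) : ℂ)))) *
    Complex.exp ((ρ : ℂ) * (1 - μ) * ((Real.log (R * r) : ℂ) + Complex.I * ((θ + φ : ℝ) : ℂ)))

/-- The (complex-valued) phase function `η(r,φ)`. -/
noncomputable def etaF (ρ : ℝ) (μ : ℂ) (R θ r φ : ℝ) : ℂ :=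
  Complex.exp ((ρ : ℂ) * ((Real.log (R * r) : ℂ) + Complex.I * ((θ - π : ℝ) : ℂ))) *
      Complex.sin ((ρ : ℂ) * (φ : ℂ)) +
    (ρ : ℂ) * (1 - μ) * (φ : ℂ)

/-- The function `A_{ρ,μ}(r,ω₁,ω₂,z)`. -/
noncomputable def AF (ρ : ℝ) (μ : ℂ) (R θ r ω₁ ω₂ : ℝ) : ℂ :=
  Complex.exp (Complex.exp ((ρ : ℂ) * ((Real.log (R * r) : ℂ) + Complex.I * ((θ - π : ℝ) : ℂ))) *
      Complex.cos ((ρ : ℂ) * (ω₁ : ℂ))) *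
    ((r ^ 2 + 2 * r * Real.cos ω₂ + 1 : ℝ) : ℂ) *
    Complex.exp (Complex.I * etaF ρ μ R θ r ω₁) *
    ((r : ℂ) + Complex.exp (Complex.I * (ω₁ : ℂ)))

/-- The kernel `K_{ρ,μ}(r,φ₁,φ₂,z)`. -/
noncomputable def KF (ρ : ℝ) (μ : ℂ) (R θ r φ₁ φ₂ : ℝ) : ℂ :=
  ((ρ : ℂ) / (2 * (π : ℂ) * Complex.I)) *
    Complex.exp ((ρ : ℂ) * (1 - μ) * ((Real.log (R * r) : ℂ) + Complex.I * (θ : ℂ))) *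
    Complex.exp (-(Complex.I * (ρ : ℂ) * (π : ℂ) * (1 - μ))) *
    (AF ρ μ R θ r φ₂ φ₁ - AF ρ μ R θ r φ₁ φ₂) /
    (((r ^ 2 + 2 * r * Real.cos φ₁ + 1 : ℝ) : ℂ) * ((r ^ 2 + 2 * r * Real.cos φ₂ + 1 : ℝ) : ℂ))

/-- The (complex-valued) phase function `χ(r,φ)`. -/
noncomputable def chiF (ρ : ℝ) (μ : ℂ) (R θ r φ : ℝ) : ℂ :=
  Complex.exp ((ρ : ℂ) * ((Real.log (R * r) : ℂ) + Complex.I * (θ : ℂ))) *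
      Complex.sin ((ρ : ℂ) * (φ : ℂ)) +
    (ρ : ℂ) * (1 - μ) * (φ : ℂ)

/-- The kernel `P_{ρ,μ}(r,φ,z)`. -/
noncomputable def PF (ρ : ℝ) (μ : ℂ) (R θ r φ : ℝ) : ℂ :=
  ((ρ : ℂ) / (2 * (π : ℂ))) *
    Complex.exp (Complex.exp ((ρ : ℂ) * ((Real.log (R * r) : ℂ) + Complex.I * (θ : ℂ))) *
      Complex.cos ((ρ : ℂ) * (φ : ℂ))) *
    Complex.exp ((ρ : ℂ) * (1 - μ) * ((Real.log (R * r) : ℂ) + Complex.I * (θ : ℂ))) *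
    Complex.exp (Complex.I * chiF ρ μ R θ r φ) *
    ((r : ℂ) * ((r : ℂ) - Complex.exp (Complex.I * (φ : ℂ)))) /
    ((r ^ 2 - 2 * r * Real.cos φ + 1 : ℝ) : ℂ)

/-- The symmetric kernel `K_{ρ,μ}(r,φ,z)` (case `δ₁ρ = δ₂ρ`). -/
noncomputable def KsymF (ρ : ℝ) (μ : ℂ) (R θ r φ : ℝ) : ℂ :=
  ((ρ : ℂ) / (π : ℂ)) *
    Complex.exp ((ρ : ℂ) * (1 - μ) * ((Real.log (R * r) : ℂ) + Complex.I * ((θ - π : ℝ) : ℂ))) *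
    Complex.exp (Complex.exp ((ρ : ℂ) * ((Real.log (R * r) : ℂ) + Complex.I * ((θ - π : ℝ) : ℂ))) *
      Complex.cos ((ρ : ℂ) * (φ : ℂ))) *
    ((r : ℂ) * Complex.sin (etaF ρ μ R θ r φ) + Complex.sin (etaF ρ μ R θ r φ + (φ : ℂ))) /
    ((r ^ 2 + 2 * r * Real.cos φ + 1 : ℝ) : ℂ)

/-- The kernel `K_{ρ,μ}(r,z)` (case `δρ = π/ρ`). -/
noncomputable def KpiF (ρ : ℝ) (μ : ℂ) (R θ r : ℝ) : ℂ :=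
  ((ρ : ℂ) / (π : ℂ)) *
    Complex.exp ((ρ : ℂ) * (1 - μ) * ((Real.log (R * r) : ℂ) + Complex.I * ((θ - π : ℝ) : ℂ))) *
    Complex.exp (-Complex.exp ((ρ : ℂ) * ((Real.log (R * r) : ℂ) + Complex.I * ((θ - π : ℝ) : ℂ)))) *
    ((r : ℂ) * Complex.sin ((π : ℂ) * (1 - μ)) +
      Complex.sin ((π : ℂ) * (1 - μ) + (π : ℂ) / (ρ : ℂ))) /
    ((r ^ 2 + 2 * r * Real.cos (π / ρ) + 1 : ℝ) : ℂ)

/-- The kernel `K′_{ρ,μ}(r,φ,z)`. -/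
noncomputable def KpF (ρ : ℝ) (μ : ℂ) (R θ r φ : ℝ) : ℂ :=
  ((ρ : ℂ) / (2 * (π : ℂ) * Complex.I)) *
    Complex.exp (Complex.exp ((ρ : ℂ) * ((Real.log (R * r) : ℂ) + Complex.I * ((θ - π : ℝ) : ℂ))) *
      Complex.cos ((ρ : ℂ) * (φ : ℂ))) *
    Complex.exp ((ρ : ℂ) * (1 - μ) * ((Real.log (R * r) : ℂ) + Complex.I * (θ : ℂ))) *
    Complex.exp (Complex.I * (etaF ρ μ R θ r φ - (π : ℂ) * (ρ : ℂ) * (1 - μ))) *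
    ((r : ℂ) + Complex.exp (Complex.I * (φ : ℂ))) /
    ((r ^ 2 + 2 * r * Real.cos φ + 1 : ℝ) : ℂ)

/-- `r(τ,ψ) = √(τ² + 2τ cos ψ + 1)`. -/
noncomputable def rP (τ ψ : ℝ) : ℝ := Real.sqrt (τ ^ 2 + 2 * τ * Real.cos ψ + 1)

/-- `φ(τ,ψ,k) = arctan(τ sin ψ / (τ cos ψ + 1)) + kπ`. -/
noncomputable def phiP (τ ψ : ℝ) (k : ℤ) : ℝ :=
  Real.arctan (τ * Real.sin ψ / (τ * Real.cos ψ + 1)) + k * π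

/-- The (complex-valued) phase `χ′(τ,ψ,k,z)`. -/
noncomputable def chiP (ρ : ℝ) (μ : ℂ) (R θ τ ψ : ℝ) (k : ℤ) : ℂ :=
  Complex.exp ((ρ : ℂ) * ((Real.log (R * rP τ ψ) : ℂ) + Complex.I * (θ : ℂ))) *
      Complex.sin ((ρ : ℂ) * (phiP τ ψ k : ℂ)) +
    (ρ : ℂ) * (1 - μ) * (phiP τ ψ k : ℂ)

/-- The kernel `P′_{ρ,μ}(τ,ψ,k,z)`. -/
noncomputable def PpF (ρ : ℝ) (μ : ℂ) (R θ τ ψ : ℝ) (k : ℤ) : ℂ :=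
  ((ρ * τ : ℝ) : ℂ) / (2 * (π : ℂ)) *
    Complex.exp (Complex.exp ((ρ : ℂ) * ((Real.log (R * rP τ ψ) : ℂ) + Complex.I * (θ : ℂ))) *
      Complex.cos ((ρ : ℂ) * (phiP τ ψ k : ℂ))) *
    Complex.exp ((ρ : ℂ) * (1 - μ) * ((Real.log (R * rP τ ψ) : ℂ) + Complex.I * (θ : ℂ))) *
    Complex.exp (Complex.I * (chiP ρ μ R θ τ ψ k + (ψ : ℂ))) *
    ((rP τ ψ : ℂ) * Complex.exp (-(Complex.I * (phiP τ ψ k : ℂ))) - 1) /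
    ((rP τ ψ ^ 2 - 2 * rP τ ψ * Real.cos (phiP τ ψ k) + 1 : ℝ) : ℂ)

/-- The integrand `e^t t^{-ν} dt` of Hankel's integral for `1 / Γ(ν)`, in the logarithmic
coordinate `t = e^w`. -/
noncomputable def hankelIntegrand (ν w : ℂ) : ℂ :=
  Complex.exp (Complex.exp w + (1 - ν) * w)

lemma differentiable_hankelIntegrand (ν : ℂ) : Differentiable ℂ (hankelIntegrand ν) := by
  unfold hankelIntegrand
  fun_prop

lemma continuous_hankelIntegrand (ν : ℂ) : Continuous (hankelIntegrand ν) :=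
  (differentiable_hankelIntegrand ν).continuous

lemma norm_hankelIntegrand (ν : ℂ) (x y : ℝ) :
    ‖hankelIntegrand ν (x + y * Complex.I)‖ =
      Real.exp (Real.exp x * Real.cos y + (1 - ν.re) * x + ν.im * y) := by
  rw [hankelIntegrand, Complex.norm_exp]
  simp [Complex.exp_re, add_assoc]

lemma exists_norm_hankelIntegrand_le (ν : ℂ) {s : Set ℝ} (hs : IsCompact s)
    (hcos : ∀ y ∈ s, Real.cos y < 0) :
    ∃ K : ℝ, ∀ x : ℝ, 0 ≤ x → ∀ y ∈ s,
      ‖hankelIntegrand ν (x + y * Complex.I)‖ ≤ K * Real.exp (-x) := by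
  rcases s.eq_empty_or_nonempty with rfl | hne
  · exact ⟨0, by simp⟩
  obtain ⟨y₀, hy₀, hmax⟩ := hs.exists_isMaxOn hne Real.continuous_cos.continuousOn
  obtain ⟨B, hB⟩ := hs.exists_bound_of_continuousOn
    (f := fun y : ℝ => ν.im * y) (by fun_prop)
  have hc : 0 < -Real.cos y₀ := by linarith [hcos y₀ hy₀]
  set c := -Real.cos y₀ with hcdef
  refine ⟨Real.exp ((2 - ν.re) ^ 2 / (2 * c) + B), fun x hx y hy => ?_⟩
  rw [norm_hankelIntegrand, ← Real.exp_add, Real.exp_le_exp]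
  have h₁ : Real.cos y ≤ -c := by simpa [hcdef] using hmax hy
  have h₂ : ν.im * y ≤ B := (le_abs_self _).trans (hB y hy)
  have h₃ : x ^ 2 / 2 ≤ Real.exp x := by
    linarith [Real.quadratic_le_exp_of_nonneg hx]
  have h₄ : Real.exp x * Real.cos y ≤ x ^ 2 / 2 * (-c) := by
    nlinarith [Real.exp_pos x]
  have h₅ : (2 - ν.re) * x - x ^ 2 / 2 * c ≤ (2 - ν.re) ^ 2 / (2 * c) := by
    rw [le_div_iff₀ (by positivity)]
    nlinarith [sq_nonneg (c * x - (2 - ν.re))]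
  linarith

lemma integrableOn_hankelIntegrand (ν : ℂ) (a : ℝ) {y : ℝ} (hy : Real.cos y < 0) :
    IntegrableOn (fun x : ℝ => hankelIntegrand ν (x + y * Complex.I)) (Set.Ioi a) := by
  have hcont : Continuous fun x : ℝ => hankelIntegrand ν (x + y * Complex.I) :=
    (continuous_hankelIntegrand ν).comp (by fun_prop)
  obtain ⟨K, hK⟩ := exists_norm_hankelIntegrand_le ν (s := {y}) isCompact_singleton (by simpa)
  refine Integrable.mono'
    (g := fun x : ℝ => ‖hankelIntegrand ν (x + y * Complex.I)‖) ?_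
    hcont.aestronglyMeasurable (by simp)
  refine integrable_of_isBigO_exp_neg zero_lt_one hcont.norm.continuousOn ?_
  refine Asymptotics.IsBigO.of_bound K ?_
  filter_upwards [Filter.eventually_ge_atTop 0] with x hx
  simpa using hK x hx y rfl

lemma tendsto_intervalIntegral_hankelIntegrand_atTop (ν : ℂ) {b b' : ℝ}
    (hcos : ∀ y ∈ Set.uIcc b b', Real.cos y < 0) :
    Filter.Tendsto (fun x : ℝ => ∫ y in b..b', hankelIntegrand ν (x + y * Complex.I))
      Filter.atTop (nhds 0) := by
  obtain ⟨K, hK⟩ := exists_norm_hankelIntegrand_le ν isCompact_uIcc hcos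
  have hlim : Filter.Tendsto (fun x : ℝ => K * Real.exp (-x) * |b' - b|)
      Filter.atTop (nhds 0) := by
    simpa using (Real.tendsto_exp_neg_atTop_nhds_zero.const_mul K).mul_const |b' - b|
  refine squeeze_zero_norm' ?_ hlim
  filter_upwards [Filter.eventually_ge_atTop 0] with x hx
  exact norm_integral_le_of_norm_le_const fun y hy => hK x hx y (Set.uIoc_subset_uIcc hy)

lemma hankelIntegrand_rectangle (ν : ℂ) (a a' b b' : ℝ) :
    (∫ x in a..a', hankelIntegrand ν (x + b * Complex.I))
      - (∫ x in a..a', hankelIntegrand ν (x + b' * Complex.I))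
      + Complex.I * (∫ y in b..b', hankelIntegrand ν (a' + y * Complex.I))
      - Complex.I * (∫ y in b..b', hankelIntegrand ν (a + y * Complex.I)) = 0 := by
  simpa using Complex.integral_boundary_rect_eq_zero_of_differentiableOn (hankelIntegrand ν)
    (a + b * Complex.I) (a' + b' * Complex.I)
    (differentiable_hankelIntegrand ν).differentiableOn

lemma integral_Ioi_hankelIntegrand_sub (ν : ℂ) (a : ℝ) {b b' : ℝ}
    (hcos : ∀ y ∈ Set.uIcc b b', Real.cos y < 0) :
    (∫ x in Set.Ioi a, hankelIntegrand ν (x + b * Complex.I))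
      - (∫ x in Set.Ioi a, hankelIntegrand ν (x + b' * Complex.I))
      = Complex.I * (∫ y in b..b', hankelIntegrand ν (a + y * Complex.I)) := by
  have h₁ := intervalIntegral_tendsto_integral_Ioi a
    (integrableOn_hankelIntegrand ν a (hcos b Set.left_mem_uIcc)) Filter.tendsto_id
  have h₂ := intervalIntegral_tendsto_integral_Ioi a
    (integrableOn_hankelIntegrand ν a (hcos b' Set.right_mem_uIcc)) Filter.tendsto_id
  have h₃ := ((h₁.sub h₂).add
    ((tendsto_intervalIntegral_hankelIntegrand_atTop ν hcos).const_mul Complex.I)).sub_const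
    (Complex.I * (∫ y in b..b', hankelIntegrand ν (a + y * Complex.I)))
  simp only [id_eq, hankelIntegrand_rectangle] at h₃
  have h₄ := tendsto_nhds_unique h₃ tendsto_const_nhds
  linear_combination h₄

/-- Hankel's integral in logarithmic coordinates, along the boundary of the half-strip
`a ≤ re w`, `b ≤ im w ≤ b'`, traversed from `+∞ + i b` to `+∞ + i b'`. -/
noncomputable def hankelIntegral (ν : ℂ) (a b b' : ℝ) : ℂ :=
  -(∫ x in Set.Ioi a, hankelIntegrand ν (x + b * Complex.I))
    + Complex.I * (∫ y in b..b', hankelIntegrand ν (a + y * Complex.I))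
    + ∫ x in Set.Ioi a, hankelIntegrand ν (x + b' * Complex.I)

lemma intervalIntegrable_hankelIntegrand (ν : ℂ) (a b b' : ℝ) :
    IntervalIntegrable (fun y : ℝ => hankelIntegrand ν (a + y * Complex.I)) volume b b' :=
  ((continuous_hankelIntegrand ν).comp (by fun_prop)).intervalIntegrable _ _

lemma cos_neg_of_mem_Ioo {y : ℝ} (hy : y ∈ Set.Ioo (π / 2) (3 * π / 2)) : Real.cos y < 0 :=
  Real.cos_neg_of_pi_div_two_lt_of_lt hy.1 (by linarith [hy.2])

lemma cos_neg_of_mem_Ioo_neg {y : ℝ} (hy : y ∈ Set.Ioo (-(3 * π / 2)) (-(π / 2))) :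
    Real.cos y < 0 := by
  rw [← Real.cos_neg]
  exact cos_neg_of_mem_Ioo ⟨by linarith [hy.2], by linarith [hy.1]⟩

lemma hankelIntegral_eq_pi (ν : ℂ) (a : ℝ) {b b' : ℝ}
    (hb : b ∈ Set.Ioo (-(3 * π / 2)) (-(π / 2))) (hb' : b' ∈ Set.Ioo (π / 2) (3 * π / 2)) :
    hankelIntegral ν a b b' = hankelIntegral ν a (-π) π := by
  have hπ := Real.pi_pos
  have h₁ := integral_Ioi_hankelIntegrand_sub ν a (b := b) (b' := -π) fun y hy =>
    cos_neg_of_mem_Ioo_neg (Set.ordConnected_Ioo.uIcc_subset hb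
      ⟨by linarith, by linarith⟩ hy)
  have h₂ := integral_Ioi_hankelIntegrand_sub ν a (b := π) (b' := b') fun y hy =>
    cos_neg_of_mem_Ioo (Set.ordConnected_Ioo.uIcc_subset
      ⟨by linarith, by linarith⟩ hb' hy)
  have h₃ := integral_add_adjacent_intervals
    (intervalIntegrable_hankelIntegrand ν a b (-π)) (intervalIntegrable_hankelIntegrand ν a (-π) π)
  have h₄ := integral_add_adjacent_intervals
    (intervalIntegrable_hankelIntegrand ν a b π) (intervalIntegrable_hankelIntegrand ν a π b')
  rw [hankelIntegral, hankelIntegral, ← h₄, ← h₃]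
  linear_combination -h₁ - h₂

lemma hankelIntegral_pi_eq (ν : ℂ) (a a' : ℝ) :
    hankelIntegral ν a (-π) π = hankelIntegral ν a' (-π) π := by
  have hsplit : ∀ y : ℝ, Real.cos y < 0 →
      ∫ x in Set.Ioi a, hankelIntegrand ν (x + y * Complex.I) =
        (∫ x in a..a', hankelIntegrand ν (x + y * Complex.I)) +
          ∫ x in Set.Ioi a', hankelIntegrand ν (x + y * Complex.I) := fun y hy =>
    (integral_interval_add_Ioi (integrableOn_hankelIntegrand ν a hy)
      (integrableOn_hankelIntegrand ν a' hy)).symm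
  have h₁ := hankelIntegrand_rectangle ν a a' (-π) π
  rw [hankelIntegral, hankelIntegral, hsplit (-π) (by simp), hsplit π (by simp)]
  linear_combination -h₁

lemma hankelIntegral_eq_self_mul (ν : ℂ) (a : ℝ) :
    hankelIntegral ν a (-π) π = ν * hankelIntegral (ν + 1) a (-π) π := by
  have hderiv : ∀ w : ℂ, HasDerivAt (hankelIntegrand (ν + 1))
      (hankelIntegrand ν w - ν * hankelIntegrand (ν + 1) w) w := fun w => by
    have h := ((Complex.hasDerivAt_exp w).add
      ((hasDerivAt_id w).const_mul (1 - (ν + 1)))).cexp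
    refine h.congr_deriv ?_
    simp only [hankelIntegrand, id_eq, Pi.add_apply]
    rw [show Complex.exp w + (1 - ν) * w = (Complex.exp w + (1 - (ν + 1)) * w) + w by ring,
      Complex.exp_add _ w]
    ring
  have hray : ∀ y : ℝ, Real.cos y < 0 →
      (∫ x in Set.Ioi a, hankelIntegrand ν (x + y * Complex.I))
        - ν * (∫ x in Set.Ioi a, hankelIntegrand (ν + 1) (x + y * Complex.I))
        = -hankelIntegrand (ν + 1) (a + y * Complex.I) := fun y hy => by
    have hint := integrableOn_hankelIntegrand ν a hy
    have hint' := (integrableOn_hankelIntegrand (ν + 1) a hy).const_mul ν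
    obtain ⟨K, hK⟩ :=
      exists_norm_hankelIntegrand_le (ν + 1) (s := {y}) isCompact_singleton (by simpa)
    have hlim : Filter.Tendsto (fun x : ℝ => hankelIntegrand (ν + 1) (x + y * Complex.I))
        Filter.atTop (nhds 0) := by
      refine squeeze_zero_norm' (a := fun x => K * Real.exp (-x)) ?_ ?_
      · filter_upwards [Filter.eventually_ge_atTop 0] with x hx using hK x hx y rfl
      · simpa using Real.tendsto_exp_neg_atTop_nhds_zero.const_mul K
    rw [← MeasureTheory.integral_const_mul, ← MeasureTheory.integral_sub hint hint',
      ← zero_sub]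
    refine integral_Ioi_of_hasDerivAt_of_tendsto ?_ ?_ (hint.sub hint') hlim
    · exact ((continuous_hankelIntegrand _).comp (by fun_prop)).continuousWithinAt
    · intro x _
      exact (HasDerivAt.comp_ofReal (HasDerivAt.comp_add_const _ _ (hderiv _)))
  have hseg : Complex.I * (∫ y in (-π)..π, hankelIntegrand ν (a + y * Complex.I))
      - ν * (Complex.I * (∫ y in (-π)..π, hankelIntegrand (ν + 1) (a + y * Complex.I)))
      = hankelIntegrand (ν + 1) (a + (π : ℝ) * Complex.I)
        - hankelIntegrand (ν + 1) (a + (-π : ℝ) * Complex.I) := by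
    have hint := (intervalIntegrable_hankelIntegrand ν a (-π) π).const_mul Complex.I
    have hint' := ((intervalIntegrable_hankelIntegrand (ν + 1) a (-π) π).const_mul
      Complex.I).const_mul ν
    rw [← intervalIntegral.integral_const_mul, ← intervalIntegral.integral_const_mul,
      ← intervalIntegral.integral_const_mul, ← intervalIntegral.integral_sub hint hint']
    refine integral_eq_sub_of_hasDerivAt
      (f := fun y : ℝ => hankelIntegrand (ν + 1) (a + y * Complex.I)) (fun y _ => ?_)
      (hint.sub hint')
    have hlin : HasDerivAt (fun y : ℝ => (a : ℂ) + y * Complex.I) Complex.I y := by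
      simpa using ((Complex.ofRealCLM.hasDerivAt (x := y)).mul_const Complex.I).const_add (a : ℂ)
    refine ((hderiv _).comp y hlin).congr_deriv ?_
    ring
  have h₁ := hray (-π) (by simp)
  have h₂ := hray π (by simp)
  rw [hankelIntegral, hankelIntegral]
  linear_combination -h₁ + h₂ + hseg

lemma hankelIntegrand_add_pi_mul_I (ν w : ℂ) :
    hankelIntegrand ν (w + π * Complex.I) =
      Complex.exp (-Complex.exp w + (1 - ν) * w) * Complex.exp ((1 - ν) * (π * Complex.I)) := by
  rw [hankelIntegrand, Complex.exp_add w, Complex.exp_pi_mul_I, ← Complex.exp_add]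
  ring_nf

lemma hankelIntegrand_add_neg_pi_mul_I (ν w : ℂ) :
    hankelIntegrand ν (w + (-π : ℝ) * Complex.I) =
      Complex.exp (-Complex.exp w + (1 - ν) * w) *
        Complex.exp (-((1 - ν) * (π * Complex.I))) := by
  rw [hankelIntegrand, Complex.exp_add w, Complex.ofReal_neg, neg_mul, Complex.exp_neg (π * _),
    Complex.exp_pi_mul_I, ← Complex.exp_add]
  ring_nf

lemma hankelIntegral_one : hankelIntegral 1 0 (-π) π = 2 * π * Complex.I := by
  have hper : Function.Periodic
      (fun y : ℝ => Complex.exp (circleMap 0 1 y)) (2 * π) := fun y => by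
    simp only [periodic_circleMap 0 1 y]
  have hmean := DiffContOnCl.circleAverage (f := Complex.exp) (c := 0) (R := 1)
    (Complex.differentiable_exp.diffContOnCl)
  rw [Real.circleAverage_def, Complex.exp_zero] at hmean
  have hshift := hper.intervalIntegral_add_eq (-π) 0
  rw [show -π + 2 * π = π by ring, zero_add] at hshift
  rw [← hshift, inv_smul_eq_iff₀ (by positivity)] at hmean
  rw [hankelIntegral]
  simp only [hankelIntegrand_add_pi_mul_I, hankelIntegrand_add_neg_pi_mul_I]
  have hcircle : (∫ y in (-π)..π, hankelIntegrand 1 ((0 : ℝ) + y * Complex.I)) = 2 * π := by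
    calc _ = ∫ y in (-π)..π, Complex.exp (circleMap 0 1 y) := by
          simp [hankelIntegrand, circleMap]
      _ = _ := by rw [hmean]; simp
  rw [hcircle]
  simp
  ring

lemma integrable_and_integral_exp_neg_exp {s : ℂ} (hs : 0 < s.re) :
    Integrable (fun x : ℝ => Complex.exp (-Complex.exp x + s * x)) ∧
      ∫ x : ℝ, Complex.exp (-Complex.exp x + s * x) = Complex.Gamma s := by
  have himage : Real.exp '' Set.univ = Set.Ioi 0 := by simp [Real.range_exp]
  have hderiv : ∀ x ∈ Set.univ, HasDerivWithinAt Real.exp (Real.exp x) Set.univ x :=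
    fun x _ => (Real.hasDerivAt_exp x).hasDerivWithinAt
  have hcongr : (fun x : ℝ => |Real.exp x| •
      (((Real.exp (-Real.exp x) : ℝ) : ℂ) * ((Real.exp x : ℝ) : ℂ) ^ (s - 1))) =
      fun x : ℝ => Complex.exp (-Complex.exp x + s * x) := by
    funext x
    rw [abs_of_pos (Real.exp_pos x), Complex.real_smul,
      Complex.cpow_def_of_ne_zero (by simp), ← Complex.ofReal_log (Real.exp_pos x).le,
      Real.log_exp]
    push_cast
    rw [← Complex.exp_add, ← Complex.exp_add]
    ring_nf
  constructor
  · have h := Complex.GammaIntegral_convergent hs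
    rw [← himage, integrableOn_image_iff_integrableOn_abs_deriv_smul MeasurableSet.univ hderiv
      Real.exp_injective.injOn, hcongr] at h
    simpa using h
  · rw [Complex.Gamma_eq_integral hs, Complex.GammaIntegral, ← himage,
      integral_image_eq_integral_abs_deriv_smul MeasurableSet.univ hderiv
      Real.exp_injective.injOn, hcongr]
    simp

lemma tendsto_intervalIntegral_hankelIntegrand_atBot {ν : ℂ} (hν : ν.re < 1) :
    Filter.Tendsto (fun a : ℝ => ∫ y in (-π)..π, hankelIntegrand ν (a + y * Complex.I))
      Filter.atBot (nhds 0) := by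
  have hlim : Filter.Tendsto (fun a : ℝ =>
      Real.exp (1 + (1 - ν.re) * a + |ν.im| * π) * |π - -π|) Filter.atBot (nhds 0) := by
    rw [← zero_mul |π - -π|]
    refine (Real.tendsto_exp_atBot.comp ?_).mul_const _
    refine Filter.tendsto_atBot_add_const_right _ _ (Filter.tendsto_atBot_add_const_left _ _ ?_)
    exact Filter.tendsto_id.const_mul_atBot (by linarith)
  refine squeeze_zero_norm' ?_ hlim
  filter_upwards [Filter.eventually_le_atBot 0] with a ha
  refine norm_integral_le_of_norm_le_const fun y hy => ?_
  rw [Set.uIoc_of_le (by linarith [Real.pi_pos])] at hy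
  rw [norm_hankelIntegrand, Real.exp_le_exp]
  have h₁ : Real.exp a * Real.cos y ≤ 1 := by
    nlinarith [Real.exp_pos a, Real.exp_le_one_iff.2 ha, Real.cos_le_one y]
  have h₂ : ν.im * y ≤ |ν.im| * π :=
    (le_abs_self _).trans (by rw [abs_mul]; gcongr; exact abs_le.2 ⟨hy.1.le, hy.2⟩)
  linarith

lemma hankelIntegral_of_re_lt_one {ν : ℂ} (hν : ν.re < 1) (a : ℝ) :
    hankelIntegral ν a (-π) π = 2 * π * Complex.I * (Complex.Gamma ν)⁻¹ := by
  have hs : 0 < (1 - ν).re := by simpa using hν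
  obtain ⟨hint, hval⟩ := integrable_and_integral_exp_neg_exp hs
  have htail := (aecover_Ioi (μ := volume) (Filter.tendsto_id (α := ℝ)
    (x := Filter.atBot))).integral_tendsto_of_countably_generated hint
  have hconst : Filter.Tendsto (fun a' : ℝ => hankelIntegral ν a' (-π) π) Filter.atBot
      (nhds (hankelIntegral ν a (-π) π)) :=
    tendsto_const_nhds.congr fun a' => hankelIntegral_pi_eq ν a a'
  have hlim := ((htail.mul_const (Complex.exp (-((1 - ν) * (π * Complex.I))))).neg.add
    ((tendsto_intervalIntegral_hankelIntegrand_atBot hν).const_mul Complex.I)).add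
    (htail.mul_const (Complex.exp ((1 - ν) * (π * Complex.I))))
  have heq := tendsto_nhds_unique hconst (hlim.congr fun a' => by
    simp only [hankelIntegral, hankelIntegrand_add_pi_mul_I, hankelIntegrand_add_neg_pi_mul_I,
      MeasureTheory.integral_mul_const, id_eq])
  rw [heq, hval]
  have hΓ := Complex.Gamma_ne_zero_of_re_pos hs
  have hrefl := Complex.Gamma_mul_Gamma_one_sub ν
  have hsin : Complex.exp ((1 - ν) * (π * Complex.I)) - Complex.exp (-((1 - ν) * (π * Complex.I)))
      = 2 * Complex.I * Complex.sin (π * ν) := by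
    rw [← Complex.sin_pi_sub, Complex.sin,
      show -(↑π - ↑π * ν) * Complex.I = -((1 - ν) * (π * Complex.I)) by ring,
      show (↑π - ↑π * ν) * Complex.I = (1 - ν) * (π * Complex.I) by ring]
    linear_combination (Complex.exp ((1 - ν) * (π * Complex.I))
      - Complex.exp (-((1 - ν) * (π * Complex.I)))) * Complex.I_sq
  have hinv : (Complex.Gamma ν)⁻¹ * π = Complex.Gamma (1 - ν) * Complex.sin (π * ν) := by
    by_cases h0 : Complex.sin (π * ν) = 0
    · rw [h0, div_zero, mul_eq_zero, or_iff_left hΓ] at hrefl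
      simp [h0, hrefl]
    · rw [eq_div_iff h0] at hrefl
      have hΓν : Complex.Gamma ν ≠ 0 := fun h => by simp [h, Real.pi_ne_zero, eq_comm] at hrefl
      field_simp
      linear_combination -hrefl
  linear_combination Complex.Gamma (1 - ν) * hsin - 2 * Complex.I * hinv

lemma hankelIntegral_pi (ν : ℂ) (a : ℝ) :
    hankelIntegral ν a (-π) π = 2 * π * Complex.I * (Complex.Gamma ν)⁻¹ := by
  obtain ⟨n, hn⟩ := exists_nat_gt (ν.re - 1)
  replace hn : ν.re < 1 + n := by linarith
  induction n generalizing ν with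
  | zero => exact hankelIntegral_of_re_lt_one (by simpa using hn) a
  | succ n ih =>
    by_cases h1 : ν = 1
    · subst h1
      rw [hankelIntegral_pi_eq 1 a 0, hankelIntegral_one]
      simp
    · have hrec := hankelIntegral_eq_self_mul (ν - 1) a
      have hΓ := Complex.one_div_Gamma_eq_self_mul_one_div_Gamma_add_one (ν - 1)
      rw [ih (ν - 1) (by push_cast at hn; simp; linarith), hΓ, sub_add_cancel] at hrec
      refine mul_left_cancel₀ (sub_ne_zero.2 h1) ?_
      linear_combination -hrec

/-- **Hankel's formula** for the reciprocal Gamma function. -/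
theorem hankelIntegral_eq (ν : ℂ) (a : ℝ) {b b' : ℝ}
    (hb : b ∈ Set.Ioo (-(3 * π / 2)) (-(π / 2))) (hb' : b' ∈ Set.Ioo (π / 2) (3 * π / 2)) :
    hankelIntegral ν a b b' = 2 * π * Complex.I * (Complex.Gamma ν)⁻¹ := by
  rw [hankelIntegral_eq_pi ν a hb hb', hankelIntegral_pi]

lemma hasSum_integral_mul_inv_pow {α : Type*} [MeasurableSpace α] {m : Measure α} {f ζ : α → ℂ}
    {q : ℝ} (hq : 1 < q) (hf : Integrable f m) (hζm : AEStronglyMeasurable ζ m)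
    (hζ : ∀ᵐ x ∂m, q ≤ ‖ζ x‖) :
    HasSum (fun k : ℕ => ∫ x, f x * (ζ x)⁻¹ ^ (k + 1) ∂m) (∫ x, f x / (ζ x - 1) ∂m) := by
  have hq0 : 0 < q := by linarith
  have hgeom : Summable fun k : ℕ => q⁻¹ ^ (k + 1) :=
    (summable_nat_add_iff 1).2
      (summable_geometric_of_lt_one (by positivity) (inv_lt_one_of_one_lt₀ hq))
  refine MeasureTheory.hasSum_integral_of_dominated_convergence
    (fun k x => ‖f x‖ * q⁻¹ ^ (k + 1)) (fun k => ?_) (fun k => ?_) ?_ ?_ ?_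
  · exact hf.aestronglyMeasurable.mul
      ((hζm.aemeasurable.inv.pow_const (k + 1)).aestronglyMeasurable)
  · filter_upwards [hζ] with x hx
    rw [norm_mul, norm_pow, norm_inv]
    gcongr
  · exact Filter.Eventually.of_forall fun x => hgeom.mul_left _
  · simp_rw [tsum_mul_left]
    exact hf.norm.mul_const _
  · filter_upwards [hζ] with x hx
    have h1 : 1 < ‖ζ x‖ := hq.trans_le hx
    have h0 : ζ x ≠ 0 := norm_pos_iff.1 (by linarith)
    have hne : ζ x - 1 ≠ 0 := sub_ne_zero.2 fun h => by simp [h] at h1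
    have h := ((hasSum_geometric_of_norm_lt_one (ξ := (ζ x)⁻¹)
      (by rw [norm_inv]; exact inv_lt_one_of_one_lt₀ h1)).mul_left (ζ x)⁻¹).mul_left (f x)
    have hval : f x / (ζ x - 1) = f x * ((ζ x)⁻¹ * (1 - (ζ x)⁻¹)⁻¹) := by
      rw [← mul_inv, mul_sub, mul_inv_cancel₀ h0, mul_one, div_eq_mul_inv]
    rw [hval]
    simpa only [pow_succ'] using h

lemma phiFun_mul_zpow (ρ : ℝ) (μ : ℂ) {R r : ℝ} (θ φ : ℝ) (hρ : ρ ≠ 0) (hR : 0 < R) (hr : 0 < r)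
    (n : ℤ) :
    phiFun ρ μ R θ r φ * ((r : ℂ) * Complex.exp (Complex.I * (φ : ℂ))) ^ (-n) =
      (ρ : ℂ) / (2 * π * Complex.I) * ((R : ℂ) * Complex.exp (Complex.I * (θ : ℂ))) ^ n *
        hankelIntegrand (μ + n / ρ)
          ((ρ * Real.log (R * r) : ℝ) + (ρ * (θ + φ) : ℝ) * Complex.I) := by
  have hpolar : ∀ x y : ℝ, 0 < x → (x : ℂ) * Complex.exp (Complex.I * (y : ℂ)) =
      Complex.exp (Real.log x + Complex.I * y) := fun x y hx => by
    rw [Complex.exp_add, ← Complex.ofReal_exp, Real.exp_log hx]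
  have hρ' : (ρ : ℂ) ≠ 0 := Complex.ofReal_ne_zero.2 hρ
  rw [hpolar r φ hr, hpolar R θ hR, ← Complex.exp_int_mul, ← Complex.exp_int_mul, phiFun,
    hankelIntegrand, Real.log_mul hR.ne' hr.ne']
  simp only [mul_assoc, ← Complex.exp_add]
  congr 2
  push_cast
  rw [show (ρ : ℂ) * (Real.log R + Real.log r) + ρ * (θ + φ) * Complex.I =
    ρ * (Real.log R + Real.log r + Complex.I * (θ + φ)) by ring]
  field_simp
  ring

lemma integral_Ioi_comp_mul_log (g : ℝ → ℂ) {ρ R c : ℝ} (hρ : 0 < ρ) (hR : 0 < R) (hc : 0 < c) :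
    (IntegrableOn g (Set.Ioi (ρ * Real.log (R * c))) ↔
        IntegrableOn (fun r : ℝ => (ρ / r) • g (ρ * Real.log (R * r))) (Set.Ioi c)) ∧
      ∫ x in Set.Ioi (ρ * Real.log (R * c)), g x =
        ∫ r in Set.Ioi c, (ρ / r) • g (ρ * Real.log (R * r)) := by
  have himage : (fun r : ℝ => ρ * Real.log (R * r)) '' Set.Ioi c =
      Set.Ioi (ρ * Real.log (R * c)) := by
    ext x
    simp only [Set.mem_image, Set.mem_Ioi]
    constructor
    · rintro ⟨r, hr, rfl⟩
      gcongr
    · intro hx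
      refine ⟨Real.exp (x / ρ) / R, ?_, ?_⟩
      · rw [lt_div_iff₀ hR, mul_comm c, ← Real.log_lt_iff_lt_exp (by positivity),
          lt_div_iff₀ hρ, mul_comm]
        exact hx
      · rw [mul_div_cancel₀ _ hR.ne', Real.log_exp, mul_div_cancel₀ _ hρ.ne']
  have hderiv : ∀ r ∈ Set.Ioi c, HasDerivWithinAt (fun r : ℝ => ρ * Real.log (R * r)) (ρ / r)
      (Set.Ioi c) r := fun r hr => by
    have hr0 : 0 < r := hc.trans hr
    have h := (((hasDerivAt_id r).const_mul R).log (mul_pos hR hr0).ne').const_mul ρ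
    refine (h.congr_deriv ?_).hasDerivWithinAt
    simp only [id_eq, mul_one]
    field_simp
  have hinj : Set.InjOn (fun r : ℝ => ρ * Real.log (R * r)) (Set.Ioi c) := fun x hx y hy hxy => by
    have hx0 : 0 < x := hc.trans hx
    have hy0 : 0 < y := hc.trans hy
    exact mul_left_cancel₀ hR.ne' (Real.log_injOn_pos (Set.mem_Ioi.2 (by positivity))
      (Set.mem_Ioi.2 (by positivity)) (mul_left_cancel₀ hρ.ne' hxy))
  have habs : Set.EqOn (fun r : ℝ => |ρ / r| • g (ρ * Real.log (R * r)))
      (fun r : ℝ => (ρ / r) • g (ρ * Real.log (R * r))) (Set.Ioi c) := fun r hr => by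
    have hr0 : 0 < r := hc.trans hr
    simp only [abs_of_pos (div_pos hρ hr0)]
  rw [← himage, integrableOn_image_iff_integrableOn_abs_deriv_smul measurableSet_Ioi hderiv hinj,
    integral_image_eq_integral_abs_deriv_smul measurableSet_Ioi hderiv hinj]
  exact ⟨integrableOn_congr_fun habs measurableSet_Ioi,
    setIntegral_congr_fun measurableSet_Ioi habs⟩

lemma norm_mul_exp_I_mul {r : ℝ} (hr : 0 < r) (φ : ℝ) :
    ‖(r : ℂ) * Complex.exp (Complex.I * (φ : ℂ))‖ = r := by
  rw [norm_mul, mul_comm Complex.I, Complex.norm_exp_ofReal_mul_I, mul_one, Complex.norm_real,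
    Real.norm_of_nonneg hr.le]

lemma hasSum_integral_ray {ρ R c θ φ : ℝ} (μ : ℂ) (hρ : 0 < ρ) (hR : 0 < R) (hc : 1 < c)
    (hcos : Real.cos (ρ * (θ + φ)) < 0) :
    HasSum (fun k : ℕ => (2 * π * Complex.I)⁻¹ *
        ((R : ℂ) * Complex.exp (Complex.I * (θ : ℂ))) ^ k *
          ∫ x in Set.Ioi (ρ * Real.log (R * c)),
            hankelIntegrand (μ + (k : ℂ) / (ρ : ℂ)) (x + (ρ * (θ + φ) : ℝ) * Complex.I))
      (∫ r in Set.Ioi c, phiFun ρ μ R θ r φ * Complex.exp (Complex.I * (φ : ℂ)) /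
        ((r : ℂ) * Complex.exp (Complex.I * (φ : ℂ)) - 1)) := by
  have hc0 : 0 < c := by linarith
  have hterm : ∀ n : ℤ, Set.EqOn
      (fun r : ℝ => phiFun ρ μ R θ r φ * Complex.exp (Complex.I * (φ : ℂ)) *
        ((r : ℂ) * Complex.exp (Complex.I * (φ : ℂ))) ^ (-(n + 1)))
      (fun r : ℝ => (2 * π * Complex.I)⁻¹ *
        ((R : ℂ) * Complex.exp (Complex.I * (θ : ℂ))) ^ n *
          ((ρ / r) • hankelIntegrand (μ + n / ρ)
            ((ρ * Real.log (R * r) : ℝ) + (ρ * (θ + φ) : ℝ) * Complex.I))) (Set.Ioi c) := by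
    intro n r hr
    have hr0 : 0 < r := hc0.trans hr
    have hr' : (r : ℂ) ≠ 0 := Complex.ofReal_ne_zero.2 hr0.ne'
    have h := phiFun_mul_zpow ρ μ θ φ hρ.ne' hR hr0 n
    have hne : (r : ℂ) * Complex.exp (Complex.I * (φ : ℂ)) ≠ 0 :=
      mul_ne_zero hr' (Complex.exp_ne_zero _)
    have hE := Complex.exp_ne_zero (Complex.I * (φ : ℂ))
    simp only [neg_add, zpow_add₀ hne, zpow_neg_one, Complex.real_smul]
    push_cast at h ⊢
    rw [mul_inv]
    field_simp at h ⊢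
    linear_combination h
  have hint : IntegrableOn
      (fun r : ℝ => phiFun ρ μ R θ r φ * Complex.exp (Complex.I * (φ : ℂ))) (Set.Ioi c) := by
    have h := hterm (-1)
    simp only [neg_add_cancel, neg_zero, zpow_zero, mul_one] at h
    rw [integrableOn_congr_fun h measurableSet_Ioi]
    exact ((integral_Ioi_comp_mul_log _ hρ hR hc0).1.1
      (integrableOn_hankelIntegrand _ _ hcos)).const_mul _
  have hsum := hasSum_integral_mul_inv_pow (q := c) hc hint
    (ζ := fun r : ℝ => (r : ℂ) * Complex.exp (Complex.I * (φ : ℂ)))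
    (Continuous.aestronglyMeasurable (by fun_prop)) (by
      filter_upwards [ae_restrict_mem measurableSet_Ioi] with r hr
      rw [norm_mul_exp_I_mul (hc0.trans hr)]
      exact le_of_lt hr)
  refine hsum.congr_fun fun k => ?_
  rw [(integral_Ioi_comp_mul_log _ hρ hR hc0).2, ← MeasureTheory.integral_const_mul]
  refine setIntegral_congr_fun measurableSet_Ioi fun r hr => ?_
  have h := hterm k hr
  simp only [Int.cast_natCast, zpow_natCast] at h
  rw [← h, ← Nat.cast_succ, zpow_neg, zpow_natCast, inv_pow]

lemma hasSum_integral_arc {ρ R c θ φ₁ φ₂ : ℝ} (μ : ℂ) (hρ : 0 < ρ) (hR : 0 < R) (hc : 1 < c)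
    (hφ : φ₁ ≤ φ₂) :
    HasSum (fun k : ℕ => (2 * π * Complex.I)⁻¹ *
        ((R : ℂ) * Complex.exp (Complex.I * (θ : ℂ))) ^ k *
          ∫ y in (ρ * (θ + φ₁))..(ρ * (θ + φ₂)),
            hankelIntegrand (μ + (k : ℂ) / (ρ : ℂ))
              ((ρ * Real.log (R * c) : ℝ) + y * Complex.I))
      (∫ φ in φ₁..φ₂, phiFun ρ μ R θ c φ * ((c : ℂ) * Complex.exp (Complex.I * (φ : ℂ))) /
        ((c : ℂ) * Complex.exp (Complex.I * (φ : ℂ)) - 1)) := by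
  have hc0 : 0 < c := by linarith
  have hcont : Continuous fun φ : ℝ =>
      phiFun ρ μ R θ c φ * ((c : ℂ) * Complex.exp (Complex.I * (φ : ℂ))) := by
    unfold phiFun
    fun_prop
  have hsum := hasSum_integral_mul_inv_pow (q := c) hc
    (hcont.integrableOn_Ioc (μ := volume) (a := φ₁) (b := φ₂))
    (ζ := fun φ : ℝ => (c : ℂ) * Complex.exp (Complex.I * (φ : ℂ)))
    (Continuous.aestronglyMeasurable (by fun_prop))
    (Filter.Eventually.of_forall fun φ => (norm_mul_exp_I_mul hc0 φ).ge)
  rw [← integral_of_le hφ] at hsum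
  refine hsum.congr_fun fun k => ?_
  rw [← integral_of_le hφ, mul_add, mul_add, add_comm (ρ * θ), add_comm (ρ * θ),
    ← smul_integral_comp_mul_add, ← intervalIntegral.integral_smul,
    ← intervalIntegral.integral_const_mul]
  refine integral_congr fun φ _ => ?_
  have hne : (c : ℂ) * Complex.exp (Complex.I * (φ : ℂ)) ≠ 0 :=
    norm_pos_iff.1 (by rwa [norm_mul_exp_I_mul hc0])
  have h := phiFun_mul_zpow ρ μ θ φ hρ.ne' hR hc0 k
  simp only [Int.cast_natCast, zpow_natCast, zpow_neg] at h
  simp only [Complex.real_smul]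
  rw [pow_succ', mul_assoc (phiFun _ _ _ _ _ _), mul_inv_cancel_left₀ hne, inv_pow, h,
    show ρ * (θ + φ) = ρ * φ + ρ * θ by ring]
  ring

/-- Theorem 1 of Saenko (contour representation, written out over real variables):
the Mittag-Leffler function as the sum of the integrals over `S₁`, `C_ϵ` and `S₂`. -/
theorem mittagLeffler_contour_repr
    (ρ ϵ δ₁ δ₂ R θ : ℝ) (μ : ℂ)
    (hρ : 1 / 2 < ρ) (hϵ : 0 < ϵ)
    (hδ₁l : π / (2 * ρ) < δ₁) (hδ₁u : δ₁ ≤ min π (π / ρ))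
    (hδ₂l : π / (2 * ρ) < δ₂) (hδ₂u : δ₂ ≤ min π (π / ρ))
    (hR : 0 < R)
    (hθl : π / (2 * ρ) - δ₂ + π < θ) (hθu : θ < -(π / (2 * ρ)) + δ₁ + π) :
    ML ρ μ ((R : ℂ) * Complex.exp (Complex.I * (θ : ℂ))) =
      -(∫ r in Set.Ioi (1 + ϵ),
          phiFun ρ μ R θ r (-δ₁ - π) * Complex.exp (Complex.I * ((-δ₁ - π : ℝ) : ℂ)) /
            ((r : ℂ) * Complex.exp (Complex.I * ((-δ₁ - π : ℝ) : ℂ)) - 1))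
      + Complex.I * (∫ φ in (-δ₁ - π)..(δ₂ - π),
          phiFun ρ μ R θ (1 + ϵ) φ * (((1 + ϵ : ℝ) : ℂ) * Complex.exp (Complex.I * (φ : ℂ))) /
            (((1 + ϵ : ℝ) : ℂ) * Complex.exp (Complex.I * (φ : ℂ)) - 1))
      + ∫ r in Set.Ioi (1 + ϵ),
          phiFun ρ μ R θ r (δ₂ - π) * Complex.exp (Complex.I * ((δ₂ - π : ℝ) : ℂ)) /
            ((r : ℂ) * Complex.exp (Complex.I * ((δ₂ - π : ℝ) : ℂ)) - 1) := by
  have hπ := Real.pi_pos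
  have hρ0 : 0 < ρ := by linarith
  have hc : 1 < 1 + ϵ := by linarith
  have hhalf : ρ * (π / (2 * ρ)) = π / 2 := by field_simp
  have hδ₁ : ρ * δ₁ ≤ π := by
    have h := (le_div_iff₀ hρ0).1 (hδ₁u.trans (min_le_right _ _))
    linarith
  have hδ₂ : ρ * δ₂ ≤ π := by
    have h := (le_div_iff₀ hρ0).1 (hδ₂u.trans (min_le_right _ _))
    linarith
  have hl := mul_lt_mul_of_pos_left hθl hρ0
  have hu := mul_lt_mul_of_pos_left hθu hρ0
  rw [mul_add, mul_sub, hhalf] at hl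
  rw [mul_add, mul_add, mul_neg, hhalf] at hu
  have hb : ρ * (θ + (-δ₁ - π)) ∈ Set.Ioo (-(3 * π / 2)) (-(π / 2)) :=
    ⟨by linarith, by linarith⟩
  have hb' : ρ * (θ + (δ₂ - π)) ∈ Set.Ioo (π / 2) (3 * π / 2) :=
    ⟨by linarith, by linarith⟩
  have hle : -δ₁ - π ≤ δ₂ - π := by
    have : 0 < π / (2 * ρ) := by positivity
    linarith
  have hsum := ((hasSum_integral_ray μ hρ0 hR hc (cos_neg_of_mem_Ioo_neg hb)).neg.add
    ((hasSum_integral_arc (θ := θ) μ hρ0 hR hc hle).mul_left Complex.I)).add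
    (hasSum_integral_ray μ hρ0 hR hc (cos_neg_of_mem_Ioo hb'))
  rw [← hsum.tsum_eq, ML]
  refine tsum_congr fun k => ?_
  have hk := hankelIntegral_eq (μ + (k : ℂ) / (ρ : ℂ)) (ρ * Real.log (R * (1 + ϵ))) hb hb'
  rw [hankelIntegral] at hk
  have hinv : (2 * π * Complex.I)⁻¹ * (2 * π * Complex.I) = 1 :=
    inv_mul_cancel₀ Complex.two_pi_I_ne_zero
  linear_combination -((2 * π * Complex.I)⁻¹ * (R * Complex.exp (Complex.I * θ)) ^ k) * hk
    - (R * Complex.exp (Complex.I * θ)) ^ k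
      * (Complex.Gamma (μ + (k : ℂ) / (ρ : ℂ)))⁻¹ * hinv
end

section
/- Let ρ > 1/2, ϵ > 0, μ ∈ ℂ, and let δ_ρ be a real number with π/(2ρ) < δ_ρ ≤ min(π, π/ρ). Let z = R·exp(iθ) with R > 0 and π/(2ρ) − δ_ρ + π < θ < −π/(2ρ) + δ_ρ + π. Then E_{ρ,μ}(z) = ∫_{1+ϵ}^{∞} K_{ρ,μ}(r, δ_ρ, z) dr + ∫_{−δ_ρ−π}^{δ_ρ−π} P_{ρ,μ}(1+ϵ, φ, z) dφ, where K_{ρ,μ}(r, φ, z) is the symmetric kernel. -/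
open scoped Real
open MeasureTheory intervalIntegral

/-- The integrand of Hankel's formula for `1 / Γ(a)` after the substitution `t = exp s`. -/
noncomputable def hankelKernel (a s : ℂ) : ℂ :=
  Complex.exp (Complex.exp s) * Complex.exp ((1 - a) * s)

theorem differentiable_hankelKernel (a : ℂ) : Differentiable ℂ (hankelKernel a) := by
  unfold hankelKernel
  fun_prop

theorem continuous_hankelKernel (a : ℂ) : Continuous (hankelKernel a) :=
  (differentiable_hankelKernel a).continuous

theorem norm_hankelKernel (a : ℂ) (x y : ℝ) :
    ‖hankelKernel a (x + y * Complex.I)‖ =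
      Real.exp (Real.exp x * Real.cos y + ((1 - a.re) * x + a.im * y)) := by
  rw [hankelKernel, norm_mul, Complex.norm_exp, Complex.norm_exp, Real.exp_add, Complex.exp_re]
  simp

/-- Cauchy's theorem on a rectangle, for an entire function. -/
theorem integral_rect_of_differentiable {f : ℂ → ℂ} (hf : Differentiable ℂ f) (c T α β : ℝ) :
    ((∫ x in c..T, f (x + β * Complex.I)) - ∫ x in c..T, f (x + α * Complex.I)) +
      Complex.I * (∫ y in α..β, f (c + y * Complex.I)) =
      Complex.I * ∫ y in α..β, f (T + y * Complex.I) := by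
  have h := Complex.integral_boundary_rect_eq_zero_of_differentiableOn f
    (c + α * Complex.I) (T + β * Complex.I) hf.differentiableOn
  simp only [Complex.add_re, Complex.ofReal_re, Complex.mul_re, Complex.I_re, mul_zero,
    Complex.ofReal_im, Complex.I_im, mul_one, sub_self, add_zero, Complex.add_im, Complex.mul_im,
    zero_add, smul_eq_mul] at h
  linear_combination -h

theorem mul_sub_mul_exp_le {κ x : ℝ} (hκ : 0 < κ) (hx : 0 ≤ x) (p : ℝ) :
    p * x - κ * Real.exp x ≤ p ^ 2 / (2 * κ) := by
  have h1 := Real.quadratic_le_exp_of_nonneg hx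
  have h2 : κ * (x ^ 2 / 2) ≤ κ * Real.exp x := by gcongr; linarith
  rw [le_div_iff₀ (by positivity)]
  nlinarith [sq_nonneg (κ * x - p)]

theorem exists_norm_hankelKernel_le (a : ℂ) {K : Set ℝ} (hK : IsCompact K)
    (hcos : ∀ y ∈ K, Real.cos y < 0) (q x₀ : ℝ) :
    ∃ C : ℝ, ∀ x, x₀ ≤ x → ∀ y ∈ K, ‖hankelKernel a (x + y * Complex.I)‖ ≤ C * Real.exp (-q * x) := by
  rcases K.eq_empty_or_nonempty with rfl | hne
  · exact ⟨0, by simp⟩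
  obtain ⟨y₁, hy₁, hmax⟩ := hK.exists_isMaxOn hne Real.continuous_cos.continuousOn
  obtain ⟨y₂, -, hmax₂⟩ := hK.exists_isMaxOn hne (f := fun y => a.im * y) (by fun_prop)
  set κ := -Real.cos y₁ * Real.exp x₀ with hκdef
  have hκ : 0 < κ := mul_pos (neg_pos.2 (hcos y₁ hy₁)) (Real.exp_pos _)
  set p := 1 - a.re + q
  refine ⟨Real.exp (p ^ 2 / (2 * κ) + p * x₀ + a.im * y₂), fun x hx y hy => ?_⟩
  rw [norm_hankelKernel, ← Real.exp_add, Real.exp_le_exp]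
  have h1 := mul_sub_mul_exp_le hκ (sub_nonneg.2 hx) p
  have h2 : κ * Real.exp (x - x₀) = -Real.cos y₁ * Real.exp x := by
    rw [hκdef, mul_assoc, ← Real.exp_add]; ring_nf
  have h3 : Real.cos y ≤ Real.cos y₁ := hmax hy
  have h4 : a.im * y ≤ a.im * y₂ := hmax₂ hy
  have h5 : Real.exp x * Real.cos y ≤ Real.exp x * Real.cos y₁ := by gcongr
  have h6 : p * (x - x₀) = (1 - a.re) * x + q * x - p * x₀ := by simp only [p]; ring
  linarith

theorem tendsto_integral_hankelKernel_zero (a : ℂ) {α β : ℝ}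
    (hcos : ∀ y ∈ Set.uIcc α β, Real.cos y < 0) :
    Filter.Tendsto (fun T : ℝ => ∫ y in α..β, hankelKernel a (T + y * Complex.I))
      Filter.atTop (nhds 0) := by
  obtain ⟨C, hC⟩ := exists_norm_hankelKernel_le a isCompact_uIcc hcos 1 0
  have hlim : Filter.Tendsto (fun T : ℝ => C * Real.exp (-1 * T) * |β - α|) Filter.atTop
      (nhds 0) := by
    have : Filter.Tendsto (fun T : ℝ => Real.exp (-1 * T)) Filter.atTop (nhds 0) := by
      simpa using Real.tendsto_exp_neg_atTop_nhds_zero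
    simpa using (this.const_mul C).mul_const |β - α|
  refine squeeze_zero_norm' ?_ hlim
  filter_upwards [Filter.eventually_ge_atTop 0] with T hT
  exact intervalIntegral.norm_integral_le_of_norm_le_const fun y hy =>
    hC T hT y (Set.uIoc_subset_uIcc hy)

theorem hankelKernel_one_integral (T : ℝ) :
    ∫ y in (-π)..π, hankelKernel 1 (T + y * Complex.I) = 2 * π := by
  have h1 : Real.circleAverage Complex.exp 0 (Real.exp T) = 1 := by
    rw [DiffContOnCl.circleAverage Complex.differentiable_exp.diffContOnCl, Complex.exp_zero]
  have h2 : ∀ y : ℝ, hankelKernel 1 (T + y * Complex.I) =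
      Complex.exp (circleMap 0 (Real.exp T) y) := fun y => by
    simp [hankelKernel, circleMap, Complex.exp_add]
  have h3 : Function.Periodic (fun y : ℝ => Complex.exp (circleMap 0 (Real.exp T) y)) (2 * π) :=
    (periodic_circleMap 0 (Real.exp T)).comp Complex.exp
  have h4 := h3.intervalIntegral_add_eq 0 (-π)
  rw [Real.circleAverage_def, inv_smul_eq_iff₀ (by positivity)] at h1
  simp_rw [h2]
  rw [show -π + 2 * π = π by ring, zero_add] at h4
  rw [← h4, h1]
  simp

theorem hankelKernel_add_pi (a : ℂ) (x : ℝ) :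
    hankelKernel a (x + (π : ℝ) * Complex.I) - hankelKernel a (x + (-π : ℝ) * Complex.I) =
      2 * Complex.I * Complex.sin (π * (1 - a)) *
        (Real.exp x • (Real.exp (-Real.exp x) * (Real.exp x : ℂ) ^ ((1 - a) - 1))) := by
  have h0 : (Real.exp x : ℂ) ≠ 0 := by simp
  have h1 : (Real.exp x : ℂ) * (Real.exp x : ℂ) ^ ((1 - a) - 1) = Complex.exp ((1 - a) * x) := by
    rw [Complex.cpow_sub _ _ h0, Complex.cpow_one, mul_div_cancel₀ _ h0,
      Complex.cpow_def_of_ne_zero h0, ← Complex.ofReal_log (Real.exp_pos x).le, Real.log_exp,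
      mul_comm]
  have h2 : Complex.exp (x + (π : ℝ) * Complex.I) = -Real.exp x := by
    rw [Complex.exp_add, Complex.exp_pi_mul_I]; simp
  have h3 : Complex.exp (x + (-π : ℝ) * Complex.I) = -Real.exp x := by
    rw [Complex.exp_add]; simp [Complex.exp_neg, Complex.exp_pi_mul_I]
  have h4 : 2 * Complex.I * Complex.sin (π * (1 - a)) =
      Complex.exp ((1 - a) * (π * Complex.I)) - Complex.exp (-((1 - a) * (π * Complex.I))) := by
    have := Complex.two_sin (π * (1 - a))
    rw [show (2 : ℂ) * Complex.I * Complex.sin (π * (1 - a)) =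
      Complex.I * (2 * Complex.sin (π * (1 - a))) by ring, this]
    rw [show -(π * (1 - a)) * Complex.I = -((1 - a) * (π * Complex.I)) by ring,
      show (π * (1 - a)) * Complex.I = ((1 - a) * (π * Complex.I)) by ring]
    linear_combination (-Complex.exp ((1 - a) * (π * Complex.I)) +
      Complex.exp (-((1 - a) * (π * Complex.I)))) * Complex.I_mul_I
  rw [Complex.real_smul, mul_left_comm (Real.exp x : ℂ), h1, hankelKernel, hankelKernel, h2, h3, h4,
    mul_add, mul_add, Complex.exp_add, Complex.exp_add]
  simp only [Complex.ofReal_neg, Complex.ofReal_exp, neg_mul, mul_neg]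
  ring

theorem tendsto_integral_gamma {b : ℂ} (hb : 0 < b.re) :
    Filter.Tendsto (fun T : ℝ => ∫ x in (-T)..T,
      Real.exp x • ((Real.exp (-Real.exp x) : ℂ) * (Real.exp x : ℂ) ^ (b - 1)))
      Filter.atTop (nhds (Complex.Gamma b)) := by
  have hcov : AECover (volume.restrict (Set.Ioi (0 : ℝ))) Filter.atTop
      (fun T : ℝ => Set.Ioc (Real.exp (-T)) (Real.exp T)) := by
    refine ⟨?_, fun _ => measurableSet_Ioc⟩
    filter_upwards [ae_restrict_mem measurableSet_Ioi] with t (ht : 0 < t)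
    filter_upwards [Real.tendsto_exp_neg_atTop_nhds_zero.eventually_lt_const ht,
      Real.tendsto_exp_atTop.eventually_ge_atTop t] with T h1 h2 using ⟨h1, h2⟩
  have h := hcov.integral_tendsto_of_countably_generated (Complex.GammaIntegral_convergent hb)
  rw [Complex.Gamma_eq_integral hb, Complex.GammaIntegral]
  refine h.congr' ?_
  filter_upwards [Filter.eventually_ge_atTop 0] with T hT
  have hle : Real.exp (-T) ≤ Real.exp T := Real.exp_le_exp.2 (by linarith)
  rw [Measure.restrict_restrict measurableSet_Ioc, Set.inter_eq_self_of_subset_left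
    (Set.Ioc_subset_Ioi_self.trans (Set.Ioi_subset_Ioi (Real.exp_pos _).le)), ← intervalIntegral.integral_of_le hle]
  refine (intervalIntegral.integral_deriv_smul_comp'' (f := Real.exp) (f' := Real.exp)
    (g := fun t : ℝ => (Real.exp (-t) : ℂ) * (t : ℂ) ^ (b - 1)) Real.continuous_exp.continuousOn
    (fun x _ => (Real.hasDerivAt_exp x).hasDerivWithinAt) Real.continuous_exp.continuousOn ?_).symm
  rintro _ ⟨x, -, rfl⟩
  refine ContinuousAt.continuousWithinAt ?_
  refine ContinuousAt.mul (by fun_prop) ?_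
  exact Complex.continuousAt_ofReal_cpow_const _ _ (Or.inr (Real.exp_pos x).ne')

theorem tendsto_integral_hankelKernel_atBot {a : ℂ} (ha : a.re < 1) :
    Filter.Tendsto (fun T : ℝ => ∫ y in (-π)..π, hankelKernel a ((-T : ℝ) + y * Complex.I))
      Filter.atTop (nhds 0) := by
  have hlim : Filter.Tendsto (fun T : ℝ => Real.exp (1 + |a.im| * π - (1 - a.re) * T) * |π - -π|)
      Filter.atTop (nhds 0) := by
    have h1 : Filter.Tendsto (fun T : ℝ => 1 + |a.im| * π - (1 - a.re) * T) Filter.atTop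
        Filter.atBot := by
      refine Filter.tendsto_atBot_add_const_left _ _ (Filter.tendsto_neg_atTop_atBot.comp ?_)
      exact Filter.tendsto_id.const_mul_atTop (by linarith)
    simpa using (Real.tendsto_exp_atBot.comp h1).mul_const |π - -π|
  refine squeeze_zero_norm' ?_ hlim
  filter_upwards [Filter.eventually_ge_atTop 0] with T hT
  refine intervalIntegral.norm_integral_le_of_norm_le_const fun y hy => ?_
  rw [Set.uIoc_of_le (by linarith [Real.pi_pos])] at hy
  rw [norm_hankelKernel, Real.exp_le_exp]
  have h1 : Real.exp (-T) * Real.cos y ≤ 1 := by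
    have : Real.exp (-T) ≤ 1 := Real.exp_le_one_iff.2 (by linarith)
    nlinarith [Real.cos_le_one y, Real.exp_pos (-T)]
  have h2 : a.im * y ≤ |a.im| * π :=
    (le_abs_self _).trans (by rw [abs_mul]; gcongr; exact abs_le.2 ⟨hy.1.le, hy.2⟩)
  linarith

theorem tendsto_integral_hankelKernel_of_re_lt_one {a : ℂ} (ha : a.re < 1) :
    Filter.Tendsto (fun T : ℝ => ∫ y in (-π)..π, hankelKernel a (T + y * Complex.I))
      Filter.atTop (nhds (2 * π * (Complex.Gamma a)⁻¹)) := by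
  have hb : 0 < (1 - a).re := by simpa using ha
  have h := ((tendsto_integral_gamma hb).const_mul (2 * Complex.sin (π * (1 - a)))).add
    (tendsto_integral_hankelKernel_atBot ha)
  have hval : 2 * Complex.sin (π * (1 - a)) * Complex.Gamma (1 - a) + 0 =
      2 * π * (Complex.Gamma a)⁻¹ := by
    have h1 := Complex.Gamma_mul_Gamma_one_sub (1 - a)
    rw [sub_sub_cancel] at h1
    have h2 : Complex.Gamma (1 - a) ≠ 0 := Complex.Gamma_ne_zero_of_re_pos hb
    by_cases hs : Complex.sin (π * (1 - a)) = 0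
    · rw [hs, div_zero, mul_eq_zero, or_iff_right h2] at h1
      simp [hs, h1]
    · have h3 : Complex.Gamma a ≠ 0 := by
        intro h0
        rw [h0, mul_zero, eq_comm, div_eq_zero_iff, or_iff_left hs] at h1
        exact Real.pi_ne_zero (by exact_mod_cast h1)
      rw [eq_div_iff hs] at h1
      rw [add_zero, eq_mul_inv_iff_mul_eq₀ h3]
      linear_combination 2 * h1
  rw [hval] at h
  refine h.congr fun T => ?_
  have hrect := integral_rect_of_differentiable (differentiable_hankelKernel a) (-T) T (-π) π
  have hc : ∀ y : ℝ, Continuous fun x : ℝ => hankelKernel a (x + y * Complex.I) := fun y =>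
    (continuous_hankelKernel a).comp (by fun_prop)
  rw [← intervalIntegral.integral_sub ((hc _).intervalIntegrable _ _)
    ((hc _).intervalIntegrable _ _)] at hrect
  simp_rw [hankelKernel_add_pi] at hrect
  rw [intervalIntegral.integral_const_mul] at hrect
  refine mul_left_cancel₀ Complex.I_ne_zero ?_
  rw [← hrect]
  ring

theorem hankelKernel_integral_recurrence (a : ℂ) :
    Filter.Tendsto (fun T : ℝ => (∫ y in (-π)..π, hankelKernel a (T + y * Complex.I)) -
      a * ∫ y in (-π)..π, hankelKernel (a + 1) (T + y * Complex.I))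
      Filter.atTop (nhds 0) := by
  have hder : ∀ s : ℂ, HasDerivAt (hankelKernel (a + 1))
      (hankelKernel a s - a * hankelKernel (a + 1) s) s := fun s => by
    have h1 := (Complex.hasDerivAt_exp s).cexp.mul
      (((hasDerivAt_id s).const_mul (1 - (a + 1))).cexp)
    refine h1.congr_deriv ?_
    have h2 : Complex.exp ((1 - a) * s) = Complex.exp s * Complex.exp ((1 - (a + 1)) * s) := by
      rw [← Complex.exp_add]; ring_nf
    simp only [hankelKernel, h2, id]
    ring
  have hc : ∀ (b : ℂ) (T : ℝ), Continuous fun y : ℝ => hankelKernel b (T + y * Complex.I) :=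
    fun b T => (continuous_hankelKernel b).comp (by fun_prop)
  have hftc : ∀ T : ℝ, Complex.I * ((∫ y in (-π)..π, hankelKernel a (T + y * Complex.I)) -
      a * ∫ y in (-π)..π, hankelKernel (a + 1) (T + y * Complex.I)) =
      hankelKernel (a + 1) (T + (π : ℝ) * Complex.I) -
        hankelKernel (a + 1) (T + (-π : ℝ) * Complex.I) := fun T => by
    rw [← intervalIntegral.integral_const_mul, ← intervalIntegral.integral_sub
      ((hc _ _).intervalIntegrable _ _) (((hc _ _).intervalIntegrable _ _).const_mul _),
      ← intervalIntegral.integral_const_mul]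
    refine intervalIntegral.integral_eq_sub_of_hasDerivAt
      (f := fun y : ℝ => hankelKernel (a + 1) (T + y * Complex.I)) (fun y _ => ?_)
      (Continuous.intervalIntegrable (by fun_prop (disch := exact hc _ _)) _ _)
    have h1 : HasDerivAt (fun y : ℝ => (T : ℂ) + y * Complex.I) Complex.I y := by
      simpa using (Complex.ofRealCLM.hasDerivAt.mul_const Complex.I).const_add (T : ℂ)
    exact ((hder _).scomp y h1).congr_deriv (by simp)
  have hend : ∀ y : ℝ, Real.cos y < 0 → Filter.Tendsto
      (fun T : ℝ => hankelKernel (a + 1) (T + y * Complex.I)) Filter.atTop (nhds 0) := by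
    intro y hy
    obtain ⟨C, hC⟩ := exists_norm_hankelKernel_le (a + 1) (isCompact_singleton (x := y))
      (by simpa using hy) 1 0
    have hlim : Filter.Tendsto (fun T : ℝ => C * Real.exp (-1 * T)) Filter.atTop (nhds 0) := by
      simpa using Real.tendsto_exp_neg_atTop_nhds_zero.const_mul C
    refine squeeze_zero_norm' ?_ hlim
    filter_upwards [Filter.eventually_ge_atTop 0] with T hT using hC T hT y rfl
  have h := ((hend π (by simp)).sub (hend (-π) (by simp))).const_mul (-Complex.I)
  simp_rw [← hftc] at h
  simpa [← mul_assoc] using h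

/-- Hankel's formula for the reciprocal Gamma function. -/
theorem tendsto_integral_hankelKernel_pi (a : ℂ) :
    Filter.Tendsto (fun T : ℝ => ∫ y in (-π)..π, hankelKernel a (T + y * Complex.I))
      Filter.atTop (nhds (2 * π * (Complex.Gamma a)⁻¹)) := by
  obtain ⟨n, hn⟩ := exists_nat_gt (a.re - 1)
  induction n generalizing a with
  | zero => exact tendsto_integral_hankelKernel_of_re_lt_one (by simpa using hn)
  | succ n ih =>
    by_cases ha : a = 1
    · subst ha
      simp [hankelKernel_one_integral]
    have ha' : a - 1 ≠ 0 := sub_ne_zero.2 ha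
    have h1 := ih (a - 1) (by simp at hn ⊢; linarith)
    have h2 := ((h1.sub (hankelKernel_integral_recurrence (a - 1)))).const_mul (a - 1)⁻¹
    rw [Complex.one_div_Gamma_eq_self_mul_one_div_Gamma_add_one] at h2
    simp only [sub_add_cancel, sub_sub_cancel, sub_zero, inv_mul_cancel_left₀ ha'] at h2
    convert h2 using 2
    field_simp

/-- Hankel's formula, with the rays of the contour tilted. -/
theorem tendsto_integral_hankelKernel (a : ℂ) {α β : ℝ} (hα : π / 2 < α) (hα' : α < 3 * π / 2)
    (hβ : β < -(π / 2)) (hβ' : -(3 * π / 2) < β) :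
    Filter.Tendsto (fun T : ℝ => ∫ y in β..α, hankelKernel a (T + y * Complex.I))
      Filter.atTop (nhds (2 * π * (Complex.Gamma a)⁻¹)) := by
  have hπ := Real.pi_pos
  have h1 : Filter.Tendsto (fun T : ℝ => ∫ y in π..α, hankelKernel a (T + y * Complex.I))
      Filter.atTop (nhds 0) := by
    refine tendsto_integral_hankelKernel_zero a fun y hy => ?_
    obtain ⟨h, h'⟩ := Set.ordConnected_Ioo (a := π / 2) (b := π + π / 2) |>.uIcc_subset
      ⟨by linarith, by linarith⟩ ⟨by linarith, by linarith⟩ hy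
    exact Real.cos_neg_of_pi_div_two_lt_of_lt h h'
  have h2 : Filter.Tendsto (fun T : ℝ => ∫ y in β..(-π), hankelKernel a (T + y * Complex.I))
      Filter.atTop (nhds 0) := by
    refine tendsto_integral_hankelKernel_zero a fun y hy => ?_
    obtain ⟨h, h'⟩ := Set.ordConnected_Ioo (a := -(π + π / 2)) (b := -(π / 2)) |>.uIcc_subset
      ⟨by linarith, by linarith⟩ ⟨by linarith, by linarith⟩ hy
    rw [← Real.cos_neg]
    exact Real.cos_neg_of_pi_div_two_lt_of_lt (by linarith) (by linarith)
  have h := (h2.add (tendsto_integral_hankelKernel_pi a)).add h1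
  rw [zero_add, add_zero] at h
  refine h.congr fun T => ?_
  have hc : Continuous fun y : ℝ => hankelKernel a (T + y * Complex.I) :=
    (continuous_hankelKernel a).comp (by fun_prop)
  rw [intervalIntegral.integral_add_adjacent_intervals (hc.intervalIntegrable _ _)
    (hc.intervalIntegrable _ _), intervalIntegral.integral_add_adjacent_intervals
    (hc.intervalIntegrable _ _) (hc.intervalIntegrable _ _)]

/-- On a tilted ray, `hankelKernel` in logarithmic coordinates is integrable at infinity. -/
theorem integrableOn_hankelKernel_ray (a : ℂ) {ρ c Λ ω : ℝ} (hρ : 0 < ρ) (hc : 0 < c)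
    (hω : Real.cos ω < 0) :
    IntegrableOn (fun r : ℝ => (r : ℂ)⁻¹ *
      hankelKernel a ((ρ * (Real.log r + Λ) : ℝ) + ω * Complex.I)) (Set.Ioi c) := by
  obtain ⟨C, hC⟩ := exists_norm_hankelKernel_le a (isCompact_singleton (x := ω))
    (by simpa using hω) ρ⁻¹ (ρ * (Real.log c + Λ))
  have hpos : ∀ r ∈ Set.Ioi c, 0 < r := fun r hr => hc.trans hr
  have hint : IntegrableOn (fun r : ℝ => C * Real.exp (-Λ) * r ^ (-2 : ℝ)) (Set.Ioi c) :=
    (integrableOn_Ioi_rpow_of_lt (by norm_num) hc).const_mul _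
  refine Integrable.mono' hint ?_ ?_
  · refine ContinuousOn.aestronglyMeasurable (fun r hr => ?_) measurableSet_Ioi
    have hr0 : r ≠ 0 := (hpos r hr).ne'
    refine ContinuousAt.continuousWithinAt (ContinuousAt.mul ?_ ?_)
    · exact Complex.continuous_ofReal.continuousAt.inv₀ (by exact_mod_cast hr0)
    · refine (continuous_hankelKernel a).continuousAt.comp ?_
      fun_prop (disch := assumption)
  · filter_upwards [ae_restrict_mem measurableSet_Ioi] with r hr
    have hr0 := hpos r hr
    have hlog : Real.log c ≤ Real.log r := Real.log_le_log hc (le_of_lt hr)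
    have h1 := hC (ρ * (Real.log r + Λ)) (by gcongr) ω rfl
    have h2 : Real.exp (-ρ⁻¹ * (ρ * (Real.log r + Λ))) = Real.exp (-Λ) * r⁻¹ := by
      rw [← Real.exp_log (inv_pos.2 hr0), ← Real.exp_add, Real.log_inv]
      congr 1
      field_simp
      ring
    rw [h2] at h1
    rw [norm_mul, norm_inv, Complex.norm_real, Real.norm_of_nonneg hr0.le]
    calc r⁻¹ * _ ≤ r⁻¹ * (C * (Real.exp (-Λ) * r⁻¹)) := by gcongr
      _ = C * Real.exp (-Λ) * r ^ (-2 : ℝ) := by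
        rw [Real.rpow_neg hr0.le, Real.rpow_two]
        field_simp

theorem integral_log_comp {f : ℝ → ℂ} (hf : Continuous f) {c T : ℝ} (hc : 0 < c) (hT : c ≤ T) :
    ∫ r in c..T, (r : ℂ)⁻¹ * f (Real.log r) = ∫ x in Real.log c..Real.log T, f x := by
  have hpos : ∀ r ∈ Set.uIcc c T, r ≠ 0 := fun r hr => by
    rw [Set.uIcc_of_le hT] at hr
    exact (hc.trans_le hr.1).ne'
  have h := intervalIntegral.integral_deriv_smul_comp (f := Real.log) (f' := fun r => r⁻¹) (g := f)
    (fun r hr => Real.hasDerivAt_log (hpos r hr)) (continuousOn_id.inv₀ hpos) hf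
  rw [← h]
  simp

/-- Hankel's formula on the contour made of the arc of radius `c` and two rays, in the variable
`ζ` with `s = ρ (log ζ + Λ + iθ)`. -/
theorem inv_Gamma_eq_contour_integral (a : ℂ) {ρ c Λ θ φ₁ φ₂ : ℝ} (hρ : 0 < ρ) (hc : 0 < c)
    (h₁ : ρ * (θ + φ₁) < -(π / 2)) (h₁' : -(3 * π / 2) < ρ * (θ + φ₁))
    (h₂ : π / 2 < ρ * (θ + φ₂)) (h₂' : ρ * (θ + φ₂) < 3 * π / 2) :
    (∫ r in Set.Ioi c, (r : ℂ)⁻¹ * hankelKernel a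
        ((ρ * (Real.log r + Λ) : ℝ) + (ρ * (θ + φ₂) : ℝ) * Complex.I)) -
      (∫ r in Set.Ioi c, (r : ℂ)⁻¹ * hankelKernel a
        ((ρ * (Real.log r + Λ) : ℝ) + (ρ * (θ + φ₁) : ℝ) * Complex.I)) +
      Complex.I * (∫ φ in φ₁..φ₂, hankelKernel a
        ((ρ * (Real.log c + Λ) : ℝ) + (ρ * (θ + φ) : ℝ) * Complex.I)) =
      2 * π * Complex.I / ρ * (Complex.Gamma a)⁻¹ := by
  have hcos₂ : Real.cos (ρ * (θ + φ₂)) < 0 :=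
    Real.cos_neg_of_pi_div_two_lt_of_lt h₂ (by linarith)
  have hcos₁ : Real.cos (ρ * (θ + φ₁)) < 0 := by
    rw [← Real.cos_neg]
    exact Real.cos_neg_of_pi_div_two_lt_of_lt (by linarith) (by linarith)
  have hscale : Filter.Tendsto (fun T : ℝ => ρ * (Real.log T + Λ)) Filter.atTop Filter.atTop :=
    (Filter.tendsto_atTop_add_const_right _ _ Real.tendsto_log_atTop).const_mul_atTop hρ
  have hr := ((tendsto_integral_hankelKernel a h₂ h₂' h₁ h₁').comp hscale).const_mul
    (Complex.I * (ρ : ℂ)⁻¹)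
  have hl := ((intervalIntegral_tendsto_integral_Ioi c
    (integrableOn_hankelKernel_ray a (Λ := Λ) hρ hc hcos₂) Filter.tendsto_id).sub
    (intervalIntegral_tendsto_integral_Ioi c
    (integrableOn_hankelKernel_ray a (Λ := Λ) hρ hc hcos₁) Filter.tendsto_id)).add_const
    (Complex.I * (∫ φ in φ₁..φ₂, hankelKernel a
        ((ρ * (Real.log c + Λ) : ℝ) + (ρ * (θ + φ) : ℝ) * Complex.I)))
  rw [show 2 * π * Complex.I / ρ * (Complex.Gamma a)⁻¹ =
    Complex.I * (ρ : ℂ)⁻¹ * (2 * π * (Complex.Gamma a)⁻¹) by ring]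
  refine tendsto_nhds_unique_of_eventuallyEq hl hr ?_
  filter_upwards [Filter.eventually_ge_atTop c] with T hT
  have hcont : ∀ y : ℝ, Continuous fun x : ℝ =>
      hankelKernel a ((ρ * (x + Λ) : ℝ) + y * Complex.I) := fun y =>
    (continuous_hankelKernel a).comp (by fun_prop)
  have hrect := integral_rect_of_differentiable
    (f := fun w => hankelKernel a (ρ * (w + Λ + θ * Complex.I)))
    ((differentiable_hankelKernel a).comp (by fun_prop)) (Real.log c) (Real.log T) φ₁ φ₂
  have harg : ∀ x y : ℝ, (ρ : ℂ) * (x + y * Complex.I + Λ + θ * Complex.I) =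
      (ρ * (x + Λ) : ℝ) + (ρ * (θ + y) : ℝ) * Complex.I := fun x y => by push_cast; ring
  simp only [harg] at hrect
  simp only [id, Function.comp_apply]
  rw [integral_log_comp (hcont _) hc hT, integral_log_comp (hcont _) hc hT, hrect, mul_assoc]
  congr 1
  have hsub := intervalIntegral.integral_comp_mul_add (a := φ₁) (b := φ₂) (c := ρ)
    (fun y : ℝ => hankelKernel a ((ρ * (Real.log T + Λ) : ℝ) + y * Complex.I)) hρ.ne' (ρ * θ)
  simp only [Complex.real_smul, Complex.ofReal_inv] at hsub
  rw [show ρ * (θ + φ₁) = ρ * φ₁ + ρ * θ by ring, show ρ * (θ + φ₂) = ρ * φ₂ + ρ * θ by ring,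
    ← hsub]
  refine intervalIntegral.integral_congr fun y _ => ?_
  simp only [mul_add, add_comm]

/-- Termwise integration of a geometric series. -/
theorem hasSum_integral_mul_pow {ν : Measure ℝ} {f v : ℝ → ℂ} {q : ℝ} (hf : Integrable f ν)
    (hv : AEStronglyMeasurable v ν) (hvq : ∀ᵐ x ∂ν, ‖v x‖ ≤ q) (hq : q < 1) (hq0 : 0 ≤ q) :
    Integrable (fun x => f x * (1 - v x)⁻¹) ν ∧
      HasSum (fun k : ℕ => ∫ x, f x * v x ^ k ∂ν) (∫ x, f x * (1 - v x)⁻¹ ∂ν) := by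
  constructor
  · refine hf.mul_bdd (c := (1 - q)⁻¹) ?_ ?_
    · exact ((hv.aemeasurable.const_sub 1).inv).aestronglyMeasurable
    · filter_upwards [hvq] with x hx
      rw [norm_inv]
      have h := norm_sub_norm_le (1 : ℂ) (v x)
      rw [norm_one] at h
      exact inv_anti₀ (by linarith) (by linarith)
  · refine hasSum_integral_of_dominated_convergence (fun k x => ‖f x‖ * q ^ k)
      (fun k => hf.aestronglyMeasurable.mul (hv.pow k)) (fun k => ?_) ?_ ?_ ?_
    · filter_upwards [hvq] with x hx
      rw [norm_mul, norm_pow]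
      gcongr
    · exact Filter.Eventually.of_forall fun x =>
        (summable_geometric_of_lt_one hq0 hq).mul_left _
    · simp_rw [tsum_mul_left]
      exact hf.norm.mul_const _
    · filter_upwards [hvq] with x hx
      exact (hasSum_geometric_of_norm_lt_one (hx.trans_lt hq)).mul_left _

theorem exp_cos_mul_exp_sin (ρ : ℝ) (μ U φ : ℂ) :
    Complex.exp (Complex.exp (ρ * U) * Complex.cos (ρ * φ)) * Complex.exp (ρ * (1 - μ) * U) *
      Complex.exp (Complex.I * (Complex.exp (ρ * U) * Complex.sin (ρ * φ) + ρ * (1 - μ) * φ)) =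
      hankelKernel μ (ρ * (U + Complex.I * φ)) := by
  have h : Complex.exp (ρ * (U + Complex.I * φ)) =
      Complex.exp (ρ * U) * (Complex.cos (ρ * φ) + Complex.sin (ρ * φ) * Complex.I) := by
    rw [← Complex.exp_mul_I, ← Complex.exp_add]
    ring_nf
  rw [hankelKernel, h, ← Complex.exp_add, ← Complex.exp_add, ← Complex.exp_add]
  ring_nf

theorem ofReal_add_exp_ne_zero {r : ℝ} (hr : 1 < r) {ω : ℂ} (hω : ω.re = 0) :
    (r : ℂ) + Complex.exp ω ≠ 0 := by
  intro h
  have h1 : ‖(r : ℂ)‖ = ‖-Complex.exp ω‖ := by rw [eq_neg_of_add_eq_zero_left h]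
  rw [norm_neg, Complex.norm_exp, hω, Real.exp_zero, Complex.norm_real,
    Real.norm_of_nonneg (by linarith)] at h1
  linarith

theorem ofReal_sq_add_cos (r φ : ℝ) : ((r ^ 2 + 2 * r * Real.cos φ + 1 : ℝ) : ℂ) =
    (r + Complex.exp (Complex.I * φ)) * (r + Complex.exp (-(Complex.I * φ))) := by
  have h := Complex.two_cos (φ : ℂ)
  have h1 : Complex.exp (Complex.I * φ) * Complex.exp (-(Complex.I * φ)) = 1 := by
    rw [← Complex.exp_add]; simp
  rw [show -(φ : ℂ) * Complex.I = -(Complex.I * φ) by ring, mul_comm (φ : ℂ)] at h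
  push_cast
  linear_combination (r : ℂ) * h - h1

theorem exp_neg_log_add {r : ℝ} (hr : 0 < r) (φ : ℝ) :
    Complex.exp (-(Real.log r + φ * Complex.I)) = (r : ℂ)⁻¹ * Complex.exp (-(Complex.I * φ)) := by
  rw [neg_add, Complex.exp_add, Complex.exp_neg, ← Complex.ofReal_exp, Real.exp_log hr, mul_comm (φ : ℂ)]

theorem PF_eq {ρ R θ r φ : ℝ} (μ : ℂ) (hR : 0 < R) (hr : 1 < r) :
    PF ρ μ R θ r φ = ρ / (2 * π * Complex.I) * (Complex.I *
      (hankelKernel μ ((ρ * (Real.log r + Real.log R) : ℝ) + (ρ * (θ + φ) : ℝ) * Complex.I) *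
        (1 - Complex.exp (-(Real.log r + φ * Complex.I)))⁻¹)) := by
  have hr0 : 0 < r := by linarith
  have hrC : (r : ℂ) ≠ 0 := by exact_mod_cast hr0.ne'
  have hadd : ((ρ * (Real.log r + Real.log R) : ℝ) : ℂ) + (ρ * (θ + φ) : ℝ) * Complex.I =
      ρ * ((Real.log (R * r) : ℂ) + Complex.I * θ + Complex.I * φ) := by
    rw [Real.log_mul hR.ne' hr0.ne']; push_cast; ring
  have hden : ((r ^ 2 - 2 * r * Real.cos φ + 1 : ℝ) : ℂ) =
      (r - Complex.exp (Complex.I * φ)) * (r - Complex.exp (-(Complex.I * φ))) := by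
    have h := ofReal_sq_add_cos (-r) φ
    push_cast at h ⊢
    linear_combination h
  have hne : ∀ ω : ℂ, ω.re = 0 → (r : ℂ) - Complex.exp ω ≠ 0 := fun ω hω h => by
    refine ofReal_add_exp_ne_zero hr (ω := ω + π * Complex.I) (by simpa using hω) ?_
    rw [Complex.exp_add, Complex.exp_pi_mul_I]
    linear_combination h
  have h1 := hne (Complex.I * φ) (by simp)
  have h2 := hne (-(Complex.I * φ)) (by simp)
  have h3 : (1 - Complex.exp (-(Real.log r + φ * Complex.I)))⁻¹ =
      r * (r - Complex.exp (-(Complex.I * φ)))⁻¹ := by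
    rw [exp_neg_log_add hr0]
    rw [show 1 - (r : ℂ)⁻¹ * Complex.exp (-(Complex.I * φ)) =
      (r : ℂ)⁻¹ * (r - Complex.exp (-(Complex.I * φ))) by field_simp, mul_inv, inv_inv]
  rw [hadd, ← exp_cos_mul_exp_sin, h3, PF, hden, chiF]
  field_simp

theorem KsymF_eq {ρ R θ r φ : ℝ} (μ : ℂ) (hR : 0 < R) (hr : 1 < r) :
    KsymF ρ μ R θ r φ = ρ / (2 * π * Complex.I) *
      ((r : ℂ)⁻¹ * hankelKernel μ ((ρ * (Real.log r + Real.log R) : ℝ) +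
          (ρ * (θ + (φ - π)) : ℝ) * Complex.I) *
          (1 - Complex.exp (-(Real.log r + (φ - π : ℝ) * Complex.I)))⁻¹ -
        (r : ℂ)⁻¹ * hankelKernel μ ((ρ * (Real.log r + Real.log R) : ℝ) +
          (ρ * (θ + (-φ - π)) : ℝ) * Complex.I) *
          (1 - Complex.exp (-(Real.log r + (-φ - π : ℝ) * Complex.I)))⁻¹) := by
  have hr0 : 0 < r := by linarith
  have hrC : (r : ℂ) ≠ 0 := by exact_mod_cast hr0.ne'
  have hadd : ∀ ψ : ℝ, ((ρ * (Real.log r + Real.log R) : ℝ) : ℂ) +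
      (ρ * (θ + (ψ - π)) : ℝ) * Complex.I =
      ρ * ((Real.log (R * r) : ℂ) + Complex.I * (θ - π : ℝ) + Complex.I * ψ) := fun ψ => by
    rw [Real.log_mul hR.ne' hr0.ne']; push_cast; ring
  have hgeom : ∀ ψ : ℝ, (1 - Complex.exp (-(Real.log r + (ψ - π : ℝ) * Complex.I)))⁻¹ =
      r * (r + Complex.exp (-(Complex.I * ψ)))⁻¹ := fun ψ => by
    rw [exp_neg_log_add hr0, show -(Complex.I * ((ψ - π : ℝ) : ℂ)) =
      -(Complex.I * ψ) + π * Complex.I by push_cast; ring, Complex.exp_add, Complex.exp_pi_mul_I,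
      show 1 - (r : ℂ)⁻¹ * (Complex.exp (-(Complex.I * ψ)) * -1) =
      (r : ℂ)⁻¹ * (r + Complex.exp (-(Complex.I * ψ))) by field_simp; ring, mul_inv, inv_inv]
  have h1 := ofReal_add_exp_ne_zero hr (ω := Complex.I * φ) (by simp)
  have h2 := ofReal_add_exp_ne_zero hr (ω := -(Complex.I * φ)) (by simp)
  have hsin : ∀ η : ℂ, Complex.sin η =
      (Complex.exp (Complex.I * η) - Complex.exp (-(Complex.I * η))) / (2 * Complex.I) := fun η => by
    rw [eq_div_iff (by simp), mul_comm, mul_right_comm, Complex.two_sin, mul_assoc, Complex.I_mul_I]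
    ring_nf
  rw [hadd, hadd, hgeom, hgeom, ← exp_cos_mul_exp_sin, ← exp_cos_mul_exp_sin, KsymF,
    ofReal_sq_add_cos]
  set U := (Real.log (R * r) : ℂ) + Complex.I * (θ - π : ℝ)
  have hη : Complex.exp (ρ * U) * Complex.sin (ρ * φ) + ρ * (1 - μ) * φ = etaF ρ μ R θ r φ := rfl
  have hη' : Complex.exp (ρ * U) * Complex.sin (ρ * (-φ : ℝ)) + ρ * (1 - μ) * (-φ : ℝ) =
      -etaF ρ μ R θ r φ := by
    rw [← hη]; push_cast; rw [mul_neg, Complex.sin_neg]; ring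
  have hcos : Complex.cos (ρ * (-φ : ℝ)) = Complex.cos (ρ * φ) := by
    push_cast; rw [mul_neg, Complex.cos_neg]
  have hneg : -(Complex.I * ((-φ : ℝ) : ℂ)) = Complex.I * φ := by push_cast; ring
  rw [hη, hη', hcos, hneg, hsin, hsin, mul_add Complex.I, neg_add, Complex.exp_add, Complex.exp_add, mul_neg]
  generalize Complex.exp (Complex.I * φ) = A at *
  generalize Complex.exp (-(Complex.I * φ)) = B at *
  generalize Complex.exp (Complex.I * etaF ρ μ R θ r φ) = E
  generalize Complex.exp (-(Complex.I * etaF ρ μ R θ r φ)) = F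
  field_simp
  ring

theorem pow_mul_hankelKernel {ρ R : ℝ} (hρ : ρ ≠ 0) (hR : 0 < R) (μ : ℂ) (θ x φ : ℝ) (k : ℕ) :
    (R * Complex.exp (Complex.I * θ)) ^ k *
      hankelKernel (μ + k / ρ)
        ((ρ * (x + Real.log R) : ℝ) + (ρ * (θ + φ) : ℝ) * Complex.I) =
      hankelKernel μ ((ρ * (x + Real.log R) : ℝ) + (ρ * (θ + φ) : ℝ) * Complex.I) *
        Complex.exp (-(x + φ * Complex.I)) ^ k := by
  have hρC : (ρ : ℂ) ≠ 0 := by exact_mod_cast hρ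
  have h1 : (R : ℂ) = Complex.exp (Real.log R) := by
    rw [← Complex.ofReal_exp, Real.exp_log hR]
  set s : ℂ := (ρ * (x + Real.log R) : ℝ) + (ρ * (θ + φ) : ℝ) * Complex.I with hs
  have h : (R * Complex.exp (Complex.I * θ)) ^ k * Complex.exp ((1 - (μ + k / ρ)) * s) =
      Complex.exp ((1 - μ) * s) * Complex.exp (-(x + φ * Complex.I)) ^ k := by
    rw [h1, ← Complex.exp_add, ← Complex.exp_nat_mul, ← Complex.exp_nat_mul, ← Complex.exp_add,
      ← Complex.exp_add, hs]
    congr 1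
    push_cast
    field_simp
    ring
  rw [hankelKernel, hankelKernel]
  linear_combination Complex.exp (Complex.exp s) * h

theorem norm_exp_neg_log_add_le {c r : ℝ} (hc : 0 < c) (hr : c ≤ r) (φ : ℝ) :
    ‖Complex.exp (-(Real.log r + φ * Complex.I))‖ ≤ c⁻¹ := by
  rw [Complex.norm_exp]
  simp only [Complex.neg_re, Complex.add_re, Complex.ofReal_re, Complex.mul_re, Complex.I_re,
    mul_zero, Complex.ofReal_im, Complex.I_im, mul_one, sub_self, add_zero]
  rw [Real.exp_neg, Real.exp_log (hc.trans_le hr)]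
  exact inv_anti₀ hc hr

/-- Corollary 1, item 1: representation "A" with the symmetric kernel (`δ₁ρ = δ₂ρ = δρ`). -/
theorem mittagLeffler_repr_A_sym
    (ρ ϵ δρ R θ : ℝ) (μ : ℂ)
    (hρ : 1 / 2 < ρ) (hϵ : 0 < ϵ)
    (hδl : π / (2 * ρ) < δρ) (hδu : δρ ≤ min π (π / ρ))
    (hR : 0 < R)
    (hθl : π / (2 * ρ) - δρ + π < θ) (hθu : θ < -(π / (2 * ρ)) + δρ + π) :
    ML ρ μ ((R : ℂ) * Complex.exp (Complex.I * (θ : ℂ))) =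
      (∫ r in Set.Ioi (1 + ϵ), KsymF ρ μ R θ r δρ) +
        ∫ φ in (-δρ - π)..(δρ - π), PF ρ μ R θ (1 + ϵ) φ := by
  have hπ := Real.pi_pos
  have hρ0 : 0 < ρ := by linarith
  have hρC : (ρ : ℂ) ≠ 0 := by exact_mod_cast hρ0.ne'
  have hc : 1 < 1 + ϵ := by linarith
  have hc0 : 0 < 1 + ϵ := by linarith
  have hhalf : ρ * (π / (2 * ρ)) = π / 2 := by field_simp
  have hδπ : ρ * δρ ≤ π := by
    have := hδu.trans (min_le_right _ _)
    rwa [le_div_iff₀' hρ0] at this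
  have hlow := mul_lt_mul_of_pos_left hθl hρ0
  have hupp := mul_lt_mul_of_pos_left hθu hρ0
  simp only [mul_add, mul_sub, mul_neg, hhalf] at hlow hupp
  have h₁ : ρ * (θ + (-δρ - π)) < -(π / 2) := by linarith
  have h₁' : -(3 * π / 2) < ρ * (θ + (-δρ - π)) := by linarith
  have h₂ : π / 2 < ρ * (θ + (δρ - π)) := by linarith
  have h₂' : ρ * (θ + (δρ - π)) < 3 * π / 2 := by linarith
  have hcos₂ : Real.cos (ρ * (θ + (δρ - π))) < 0 :=
    Real.cos_neg_of_pi_div_two_lt_of_lt h₂ (by linarith)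
  have hcos₁ : Real.cos (ρ * (θ + (-δρ - π))) < 0 := by
    rw [← Real.cos_neg]
    exact Real.cos_neg_of_pi_div_two_lt_of_lt (by linarith) (by linarith)
  have hle : -δρ - π ≤ δρ - π := by
    have : 0 < π / (2 * ρ) := by positivity
    linarith
  have hq1 : (1 + ϵ)⁻¹ < 1 := inv_lt_one_of_one_lt₀ hc
  have hq0 : 0 ≤ (1 + ϵ)⁻¹ := by positivity
  have hv : ∀ φ : ℝ, AEStronglyMeasurable
      (fun r : ℝ => Complex.exp (-(Real.log r + φ * Complex.I)))
      (volume.restrict (Set.Ioi (1 + ϵ))) := fun φ => by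
    refine Measurable.aestronglyMeasurable ?_
    fun_prop
  have hvq : ∀ φ : ℝ, ∀ᵐ r ∂(volume.restrict (Set.Ioi (1 + ϵ))),
      ‖Complex.exp (-(Real.log r + φ * Complex.I))‖ ≤ (1 + ϵ)⁻¹ := fun φ => by
    filter_upwards [ae_restrict_mem measurableSet_Ioi] with r hr
    exact norm_exp_neg_log_add_le hc0 (le_of_lt hr) φ
  obtain ⟨hi₂, hs₂⟩ := hasSum_integral_mul_pow
    (integrableOn_hankelKernel_ray μ (Λ := Real.log R) hρ0 hc0 hcos₂)
    (hv (δρ - π)) (hvq (δρ - π)) hq1 hq0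
  obtain ⟨hi₁, hs₁⟩ := hasSum_integral_mul_pow
    (integrableOn_hankelKernel_ray μ (Λ := Real.log R) hρ0 hc0 hcos₁)
    (hv (-δρ - π)) (hvq (-δρ - π)) hq1 hq0
  have hcont : Continuous fun φ : ℝ => hankelKernel μ
      ((ρ * (Real.log (1 + ϵ) + Real.log R) : ℝ) + (ρ * (θ + φ) : ℝ) * Complex.I) :=
    (continuous_hankelKernel μ).comp (by fun_prop)
  have hs₀ := (hasSum_integral_mul_pow
    (v := fun φ : ℝ => Complex.exp (-(Real.log (1 + ϵ) + φ * Complex.I)))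
    (hcont.intervalIntegrable (μ := volume) (-δρ - π) (δρ - π)).1
    (Continuous.aestronglyMeasurable (by fun_prop))
    (Filter.Eventually.of_forall fun φ => norm_exp_neg_log_add_le hc0 le_rfl φ) hq1 hq0).2
  have hsum := ((hs₂.sub hs₁).add (hs₀.mul_left Complex.I)).mul_left
    ((ρ : ℂ) / (2 * π * Complex.I))
  have hterm : ∀ k : ℕ, ((R : ℂ) * Complex.exp (Complex.I * θ)) ^ k *
      (Complex.Gamma (μ + (k : ℂ) / (ρ : ℂ)))⁻¹ = (ρ : ℂ) / (2 * π * Complex.I) *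
      ((∫ r in Set.Ioi (1 + ϵ), (r : ℂ)⁻¹ * hankelKernel μ
          ((ρ * (Real.log r + Real.log R) : ℝ) + (ρ * (θ + (δρ - π)) : ℝ) * Complex.I) *
          Complex.exp (-(Real.log r + (δρ - π : ℝ) * Complex.I)) ^ k) -
        (∫ r in Set.Ioi (1 + ϵ), (r : ℂ)⁻¹ * hankelKernel μ
          ((ρ * (Real.log r + Real.log R) : ℝ) + (ρ * (θ + (-δρ - π)) : ℝ) * Complex.I) *
          Complex.exp (-(Real.log r + (-δρ - π : ℝ) * Complex.I)) ^ k) +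
        Complex.I * ∫ φ in Set.Ioc (-δρ - π) (δρ - π), hankelKernel μ
          ((ρ * (Real.log (1 + ϵ) + Real.log R) : ℝ) + (ρ * (θ + φ) : ℝ) * Complex.I) *
          Complex.exp (-(Real.log (1 + ϵ) + φ * Complex.I)) ^ k) := fun k => by
    have h := inv_Gamma_eq_contour_integral (μ + (k : ℂ) / (ρ : ℂ)) (Λ := Real.log R) hρ0 hc0
      h₁ h₁' h₂ h₂'
    simp only [mul_assoc ((_ : ℂ)⁻¹), ← pow_mul_hankelKernel hρ0.ne' hR]
    simp only [mul_left_comm ((_ : ℂ)⁻¹), MeasureTheory.integral_const_mul]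
    rw [intervalIntegral.integral_of_le hle] at h
    rw [mul_left_comm Complex.I, ← mul_sub, ← mul_add, h]
    field_simp
  rw [ML, tsum_congr hterm, hsum.tsum_eq, mul_add, ← MeasureTheory.integral_sub hi₂ hi₁,
    intervalIntegral.integral_of_le hle, ← MeasureTheory.integral_const_mul,
    ← MeasureTheory.integral_const_mul, ← MeasureTheory.integral_const_mul]
  congr 1
  · refine setIntegral_congr_fun measurableSet_Ioi fun r hr => ?_
    exact (KsymF_eq μ hR (hc.trans hr)).symm
  · exact MeasureTheory.integral_congr_ae (Filter.Eventually.of_forall fun φ => (PF_eq μ hR hc).symm)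
end
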